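/- arXiv:2306.12209 — 7 statements merged into one kernel-verified Lean document; each statement's English description precedes it below -/
import Mathlib

section
/- Let m ≥ 4 be an integer. Then the digraph C_m*[2] has a factorization into r K_2*-factors and s C⃗_{2m}-factors for every r ∈ {0, 2, 4} with r + s = 4. -/
/-- A factorization of the digraph with arc set `A` (on vertex set `V`) into `k`
arc-disjoint spanning factors, where every connected component of the `i`-th factor
is a directed cycle of length `c i` (a `C⃗_{c i}`-factor; for `c i = 2` this is a
`K_2*`-factor, i.e. its components are double arcs).  The `i`-th factor is encoded by
a permutation `f i` of the vertex set, its arc set being `{(x, f i x) : x ∈ V}`;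
the requirement that all components be directed `c i`-cycles says exactly that every
point of `f i` has minimal period `c i`.  The factors are pairwise arc-disjoint and
their arc sets partition `A`. -/
def IsFactorization {V : Type} (A : Set (V × V)) {k : ℕ} (c : Fin k → ℕ) : Prop :=
  ∃ f : Fin k → Equiv.Perm V,
    (∀ (i : Fin k) (x : V), Function.minimalPeriod (⇑(f i)) x = c i) ∧
    (∀ (i j : Fin k) (x : V), f i x = f j x → i = j) ∧
    (∀ p : V × V, p ∈ A ↔ ∃ i, f i p.1 = p.2)

/-- The arc set of `C_m*[2]` on vertex set `Fin 2 × ZMod m`: here `C_m*` is the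
symmetric digraph of the `m`-cycle `(0, 1, …, m-1)` on `ZMod m`, and `D[2]` has an arc
from `(i, u)` to `(j, v)` for all `i j : Fin 2` whenever `(u, v)` is an arc of `D`. -/
def cycleStarBlowup (m : ℕ) : Set ((Fin 2 × ZMod m) × (Fin 2 × ZMod m)) :=
  {p | p.2.2 = p.1.2 + 1 ∨ p.1.2 = p.2.2 + 1}

/-- The arc set of `I*_{2m}` on vertex set `Fin 2 × ZMod m`: the `K_2*`-factor whose
components are the double arcs joining `(0, i)` and `(1, i)` for each `i : ZMod m`. -/
def IStar (m : ℕ) : Set ((Fin 2 × ZMod m) × (Fin 2 × ZMod m)) :=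
  {p | p.1.2 = p.2.2 ∧ p.1.1 ≠ p.2.1}

/-- The arc set of `F_m*[2]` on vertex set `Fin 2 × ZMod m` (for even `m`): here `F_m`
is the 1-factor of `K_m` on `ZMod m` with edges `{0, m/2}` and `{i, m - i}` for
`1 ≤ i ≤ m/2 - 1`, `F_m*` is its symmetric digraph, and `D[2]` has an arc from `(i, u)`
to `(j, v)` for all `i j : Fin 2` whenever `(u, v)` is an arc of `D`. -/
def FStarBlowup (m : ℕ) : Set ((Fin 2 × ZMod m) × (Fin 2 × ZMod m)) :=
  {p | (p.1.2 = 0 ∧ p.2.2 = ((m / 2 : ℕ) : ZMod m)) ∨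
       (p.1.2 = ((m / 2 : ℕ) : ZMod m) ∧ p.2.2 = 0) ∨
       (p.1.2 ≠ 0 ∧ p.1.2 ≠ ((m / 2 : ℕ) : ZMod m) ∧ p.2.2 = -p.1.2)}

/-- The arc set of `Γ*_m = C*[2] ⊕ F_m*[2]`, the arc-disjoint union of `C*[2]` and
`F_m*[2]` on vertex set `Fin 2 × ZMod m`. -/
def GammaStar (m : ℕ) : Set ((Fin 2 × ZMod m) × (Fin 2 × ZMod m)) :=
  cycleStarBlowup m ∪ FStarBlowup m

/-- If `σ` shifts an injective `ZMod n`-valued labelling by one, all its orbits are `n`-cycles. -/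
lemma minimalPeriod_eq_of_label {V : Type} {n : ℕ} (σ : Equiv.Perm V) (pos : V → ZMod n)
    (hinj : Function.Injective pos) (hstep : ∀ x, pos (σ x) = pos x + 1) (x : V) :
    Function.minimalPeriod σ x = n := by
  have hiter : ∀ k : ℕ, pos (σ^[k] x) = pos x + k := by
    intro k
    induction k with
    | zero => simp
    | succ k ih => rw [Function.iterate_succ_apply', hstep, ih]; push_cast; ring
  apply Nat.dvd_antisymm
  · apply Function.IsPeriodicPt.minimalPeriod_dvd
    apply hinj
    rw [hiter]; simp
  · rw [← ZMod.natCast_eq_zero_iff]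
    have h := hiter (Function.minimalPeriod σ x)
    rw [Function.iterate_minimalPeriod] at h
    simpa using h.symm

lemma minimalPeriod_eq_two {V : Type} {g : V → V} {x : V} (h : g (g x) = x) (hne : g x ≠ x) :
    Function.minimalPeriod g x = 2 :=
  Function.minimalPeriod_eq_prime (p := 2) h hne

/-- The digraph with adjacency relation `E` splits into two factors all of whose components
are directed `c`-cycles. -/
def SplitsInTwo {V : Type} (E : V → V → Prop) (c : ℕ) : Prop :=
  ∃ f g : Equiv.Perm V, (∀ x, Function.minimalPeriod f x = c) ∧
    (∀ x, Function.minimalPeriod g x = c) ∧ (∀ x, f x ≠ g x) ∧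
    ∀ x y, E x y ↔ f x = y ∨ g x = y

lemma SplitsInTwo.comap {V : Type} {E : V → V → Prop} {c : ℕ} (h : SplitsInTwo E c)
    (φ : Equiv.Perm V) : SplitsInTwo (fun x y => E (φ x) (φ y)) c := by
  obtain ⟨f, g, hf, hg, hne, hE⟩ := h
  have key : ∀ (f : Equiv.Perm V), (∀ x, Function.minimalPeriod f x = c) → ∀ x,
      Function.minimalPeriod (φ⁻¹ * f * φ : Equiv.Perm V) x = c := by
    intro f hf x
    rw [← hf (φ x)]
    apply Function.minimalPeriod_eq_minimalPeriod_iff.2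
    intro n
    have : ∀ n : ℕ, φ ((φ⁻¹ * f * φ : Equiv.Perm V)^[n] x) = f^[n] (φ x) := by
      intro n
      induction n with
      | zero => rfl
      | succ n ih => rw [Function.iterate_succ_apply', Function.iterate_succ_apply', ← ih]; simp
    simp only [Function.IsPeriodicPt, Function.IsFixedPt]
    rw [← this, φ.injective.eq_iff]
  refine ⟨φ⁻¹ * f * φ, φ⁻¹ * g * φ, key f hf, key g hg, fun x => by simpa using hne (φ x), ?_⟩
  intro x y
  change E (φ x) (φ y) ↔ φ.symm (f (φ x)) = y ∨ φ.symm (g (φ x)) = y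
  rw [hE, Equiv.symm_apply_eq, Equiv.symm_apply_eq]

/-- An undirected cycle of even length `2 * m`, seen as a symmetric digraph, splits into its two
orientations and into two perfect matchings. -/
lemma splitsInTwo_of_label {V : Type} {m : ℕ} (hm : 2 ≤ m) {E : V → V → Prop} (σ : Equiv.Perm V)
    (pos : V → ZMod (2 * m)) (hinj : Function.Injective pos)
    (hstep : ∀ x, pos (σ x) = pos x + 1) (hE : ∀ x y, E x y ↔ σ x = y ∨ σ⁻¹ x = y) :
    SplitsInTwo E (2 * m) ∧ SplitsInTwo E 2 := by
  have hstep' : ∀ x, pos (σ⁻¹ x) = pos x - 1 := by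
    intro x
    have := hstep (σ⁻¹ x)
    rw [show σ (σ⁻¹ x) = x from σ.apply_symm_apply x] at this
    rw [this]; ring
  have h2 : (2 : ZMod (2 * m)) ≠ 0 := by
    intro h
    have : ((2 : ℕ) : ZMod (2 * m)) = 0 := by exact_mod_cast h
    rw [ZMod.natCast_eq_zero_iff] at this
    have := Nat.le_of_dvd (by norm_num) this
    omega
  have hne : ∀ x, σ x ≠ σ⁻¹ x := by
    intro x h
    have := congrArg pos h
    rw [hstep, hstep'] at this
    exact h2 (by linear_combination this)
  have hper := minimalPeriod_eq_of_label σ pos hinj hstep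
  refine ⟨⟨σ, σ⁻¹, hper, ?_, hne, hE⟩, ?_⟩
  · have hinj' : Function.Injective (fun x => - pos x) := fun x y h => hinj (neg_injective h)
    exact minimalPeriod_eq_of_label σ⁻¹ _ hinj' fun x => by rw [hstep']; ring
  · let χ : V → ZMod 2 := fun x => ZMod.castHom (dvd_mul_right 2 m) (ZMod 2) (pos x)
    have two : ∀ a : ZMod 2, a = 0 ∨ a = 1 := by decide
    have hχ : ∀ x, χ (σ x) = χ x + 1 := fun x => by simp only [χ, hstep, map_add, map_one]
    have hχ' : ∀ x, χ (σ⁻¹ x) = χ x + 1 := fun x => by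
      simp only [χ, hstep', map_sub, map_one]
      exact CharTwo.sub_eq_add _ _
    have one : (1 : ZMod 2) ≠ 0 := by decide
    let g : ZMod 2 → V → V := fun a x => if χ x = a then σ x else σ⁻¹ x
    have hg : ∀ a, Function.Involutive (g a) := by
      intro a x
      by_cases h : χ x = a
      · have : χ (σ x) ≠ a := by rw [hχ, h]; simp
        simp only [g, h, this, if_true, if_false]
        exact σ.symm_apply_apply x
      · have : χ (σ⁻¹ x) = a := by
          rw [hχ']
          have cases : ∀ a b : ZMod 2, b ≠ a → b + 1 = a := by decide
          exact cases _ _ h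
        simp only [g, h, this, if_true, if_false]
        exact σ.apply_symm_apply x
    have hgne : ∀ a x, g a x ≠ x := by
      intro a x h
      have : χ (g a x) = χ x + 1 := by
        by_cases h : χ x = a <;> simp only [g, h, if_true, if_false, hχ, hχ']
      rw [h] at this
      exact one (left_eq_add.1 this)
    have hval : ∀ x, g 0 x = σ x ∧ g 1 x = σ⁻¹ x ∨ g 0 x = σ⁻¹ x ∧ g 1 x = σ x := by
      intro x
      rcases two (χ x) with h | h <;> simp [g, h]
    refine ⟨(hg 0).toPerm, (hg 1).toPerm, fun x => minimalPeriod_eq_two (hg 0 x) (hgne 0 x),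
      fun x => minimalPeriod_eq_two (hg 1 x) (hgne 1 x), fun x => ?_, fun x y => ?_⟩
    · simp only [Function.Involutive.coe_toPerm]
      rcases hval x with ⟨h, h'⟩ | ⟨h, h'⟩ <;> rw [h, h']
      · exact hne x
      · exact (hne x).symm
    · simp only [Function.Involutive.coe_toPerm]
      rw [hE]
      rcases hval x with ⟨h, h'⟩ | ⟨h, h'⟩ <;> rw [h, h']
      exact or_comm

lemma isFactorization_of_splitsInTwo {V : Type} {A : Set (V × V)} {E F : V → V → Prop}
    {a b : ℕ} (hE : SplitsInTwo E a) (hF : SplitsInTwo F b)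
    (hdisj : ∀ x y, E x y → ¬ F x y) (hA : ∀ p : V × V, p ∈ A ↔ E p.1 p.2 ∨ F p.1 p.2) :
    IsFactorization A ![a, a, b, b] := by
  obtain ⟨f, g, hf, hg, hne, hE⟩ := hE
  obtain ⟨f', g', hf', hg', hne', hF⟩ := hF
  have h1 : ∀ x, f x ≠ f' x := fun x h => hdisj x (f x) (by simp [hE]) (by simp [hF, h])
  have h2 : ∀ x, f x ≠ g' x := fun x h => hdisj x (f x) (by simp [hE]) (by simp [hF, h])
  have h3 : ∀ x, g x ≠ f' x := fun x h => hdisj x (g x) (by simp [hE]) (by simp [hF, h])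
  have h4 : ∀ x, g x ≠ g' x := fun x h => hdisj x (g x) (by simp [hE]) (by simp [hF, h])
  refine ⟨![f, g, f', g'], ?_, ?_, ?_⟩
  · intro i x
    fin_cases i <;> simp [hf, hg, hf', hg']
  · intro i j x
    fin_cases i <;> fin_cases j <;>
      simp [hne, hne', h1, h2, h3, h4, (hne _).symm, (hne' _).symm, (h1 _).symm, (h2 _).symm,
        (h3 _).symm, (h4 _).symm]
  · intro p
    rw [hA, hE, hF, Fin.exists_fin_succ, Fin.exists_fin_succ, Fin.exists_fin_two]
    simp [or_assoc]

section HamiltonCycle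

variable {m : ℕ}

/-- Whether the edge from `(i, u)` to `(j, u + 1)` lies on the Hamilton cycle
`(0, 0), (0, 1), …, (0, m - 1), (1, 0), (1, m - 1), …, (1, 1)`. -/
def upEdge (i : Fin 2) (u : ZMod m) (j : Fin 2) : Prop :=
  if u = 0 then i = 0 else if u = -1 then j = 1 else i = j

/-- Adjacency in the Hamilton cycle `(0, 0), (0, 1), …, (0, m - 1), (1, 0), (1, m - 1), …, (1, 1)`
of `C_m[2]`. -/
def hamAdj (x y : Fin 2 × ZMod m) : Prop :=
  (y.2 = x.2 + 1 ∧ upEdge x.1 x.2 y.1) ∨ (x.2 = y.2 + 1 ∧ upEdge y.1 y.2 x.1)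

/-- The successor along the Hamilton cycle. -/
def hamSucc (m : ℕ) : Equiv.Perm (Fin 2 × ZMod m) where
  toFun x := if x.1 = 0 then (if x.2 = -1 then (1, 0) else (0, x.2 + 1))
    else (if x.2 = 1 then (0, 0) else (1, x.2 - 1))
  invFun x := if x.2 = 0 then (if x.1 = 0 then (1, 1) else (0, -1))
    else if x.1 = 0 then (0, x.2 - 1) else (1, x.2 + 1)
  left_inv := by
    rintro ⟨i, u⟩
    fin_cases i <;> grind
  right_inv := by
    rintro ⟨i, u⟩
    fin_cases i <;> grind

/-- The position of a vertex on the Hamilton cycle. -/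
def hamPos (x : Fin 2 × ZMod m) : ℕ :=
  if x.1 = 0 then x.2.val else if x.2.val = 0 then m else 2 * m - x.2.val

/-- The involution swapping the Hamilton cycle with its complement. -/
def levelTwist (m : ℕ) : Equiv.Perm (Fin 2 × ZMod m) :=
  Function.Involutive.toPerm
    (fun x => if Even x.2.val then (x.1 + 1, x.2) else x) (by
      rintro ⟨i, u⟩
      by_cases h : Even u.val <;> fin_cases i <;> simp [h])

lemma zmod_val_add_one (hm : 4 ≤ m) (u : ZMod m) :
    u = -1 ∧ u.val = m - 1 ∧ (u + 1).val = 0 ∨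
      u ≠ -1 ∧ u.val + 1 < m ∧ (u + 1).val = u.val + 1 := by
  have : NeZero m := ⟨by omega⟩
  have : Fact (1 < m) := ⟨by omega⟩
  have hlt := u.val_lt
  have hval := ZMod.val_add u 1
  rw [ZMod.val_one] at hval
  by_cases h : u.val + 1 = m
  · rw [h, Nat.mod_self] at hval
    have := (ZMod.val_eq_zero _).1 hval
    exact Or.inl ⟨by linear_combination this, by omega, hval⟩
  · rw [Nat.mod_eq_of_lt (by omega)] at hval
    refine Or.inr ⟨?_, by omega, hval⟩
    rintro rfl
    simp at hval

lemma hamAdj_iff (hm : 4 ≤ m) (x y : Fin 2 × ZMod m) :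
    hamAdj x y ↔ hamSucc m x = y ∨ (hamSucc m)⁻¹ x = y := by
  have : Fact (1 < m) := ⟨by omega⟩
  have : Fact (2 < m) := ⟨by omega⟩
  have h1 : (1 : ZMod m) ≠ 0 := one_ne_zero
  have h2 : (1 : ZMod m) ≠ -1 := ZMod.neg_one_ne_one.symm
  rw [Equiv.Perm.inv_eq_iff_eq, eq_comm (a := x)]
  obtain ⟨i, u⟩ := x
  obtain ⟨j, v⟩ := y
  fin_cases i <;> fin_cases j <;> simp [hamAdj, upEdge, hamSucc] <;> grind

lemma hamPos_lt (hm : 4 ≤ m) (x : Fin 2 × ZMod m) : hamPos x < 2 * m := by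
  have : NeZero m := ⟨by omega⟩
  have := x.2.val_lt
  unfold hamPos
  split_ifs <;> omega

lemma hamPos_injective (hm : 4 ≤ m) : Function.Injective (hamPos (m := m)) := by
  have : NeZero m := ⟨by omega⟩
  rintro ⟨i, u⟩ ⟨j, v⟩ h
  have hu := u.val_lt
  have hv := v.val_lt
  rw [Prod.mk.injEq, ← (ZMod.val_injective m).eq_iff]
  unfold hamPos at h
  fin_cases i <;> fin_cases j <;> simp at h ⊢ <;> grind

lemma hamPos_hamSucc (hm : 4 ≤ m) (x : Fin 2 × ZMod m) :
    (hamPos (hamSucc m x) : ZMod (2 * m)) = hamPos x + 1 := by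
  have key : hamPos (hamSucc m x) = hamPos x + 1 ∨
      hamPos (hamSucc m x) = 0 ∧ hamPos x + 1 = 2 * m := by
    have : NeZero m := ⟨by omega⟩
    have : Fact (1 < m) := ⟨by omega⟩
    obtain ⟨i, u⟩ := x
    have hz : ∀ u : ZMod m, u.val = 0 ↔ u = 0 := ZMod.val_eq_zero
    fin_cases i
    · have := zmod_val_add_one hm u
      simp only [hamPos, hamSucc]
      simp
      grind
    · have := zmod_val_add_one hm (u - 1)
      have h1 : (1 : ZMod m) ≠ 0 := one_ne_zero
      rw [sub_add_cancel] at this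
      have hlt := u.val_lt
      have e1 : u - 1 = -1 ↔ u = 0 := by grind
      have e2 := hz u
      have e3 := hz (u - 1)
      have e4 : u - 1 = 0 ↔ u = 1 := sub_eq_zero
      simp only [hamPos, hamSucc]
      simp
      grind
  rcases key with h | ⟨h, h'⟩
  · rw [h]; push_cast; rfl
  · have : ((hamPos x + 1 : ℕ) : ZMod (2 * m)) = 0 := by rw [h']; exact ZMod.natCast_self _
    rw [h]; push_cast at this ⊢; exact this.symm

lemma splitsInTwo_hamAdj (hm : 4 ≤ m) :
    SplitsInTwo (hamAdj (m := m)) (2 * m) ∧ SplitsInTwo (hamAdj (m := m)) 2 := by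
  refine splitsInTwo_of_label (by omega) (hamSucc m) (fun x => (hamPos x : ZMod (2 * m))) ?_
    (hamPos_hamSucc hm) (hamAdj_iff hm)
  intro x y h
  apply hamPos_injective hm
  have := (ZMod.natCast_eq_natCast_iff' _ _ _).1 h
  rwa [Nat.mod_eq_of_lt (hamPos_lt hm x), Nat.mod_eq_of_lt (hamPos_lt hm y)] at this

lemma levelTwist_apply (x : Fin 2 × ZMod m) :
    levelTwist m x = if Even x.2.val then (x.1 + 1, x.2) else x := rfl

lemma levelTwist_snd (x : Fin 2 × ZMod m) : (levelTwist m x).2 = x.2 := by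
  rw [levelTwist_apply]
  split_ifs <;> rfl

lemma upEdge_levelTwist (hm : 4 ≤ m) (i j : Fin 2) (u : ZMod m) :
    upEdge (levelTwist m (i, u)).1 u (levelTwist m (j, u + 1)).1 ↔ ¬ upEdge i u j := by
  have : Fact (1 < m) := ⟨by omega⟩
  have := zmod_val_add_one hm u
  simp only [levelTwist_apply, upEdge]
  by_cases h0 : u = 0
  · subst h0
    fin_cases i <;> simp
  by_cases h1 : u = -1
  · subst h1
    fin_cases j <;> simp
  · obtain ⟨-, -, h⟩ := this.resolve_left (fun h => h1 h.1)
    simp only [h, h0, h1, if_false, Nat.even_add_one]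
    by_cases he : Even u.val <;> fin_cases i <;> fin_cases j <;> simp [he]

lemma hamAdj_levelTwist (hm : 4 ≤ m) (x y : Fin 2 × ZMod m) :
    hamAdj (levelTwist m x) (levelTwist m y) ↔
      (x, y) ∈ cycleStarBlowup m ∧ ¬ hamAdj x y := by
  have : Fact (2 < m) := ⟨by omega⟩
  have h2 : (1 : ZMod m) ≠ -1 := ZMod.neg_one_ne_one.symm
  obtain ⟨i, u⟩ := x
  obtain ⟨j, v⟩ := y
  simp only [hamAdj, levelTwist_snd, cycleStarBlowup, Set.mem_ofPred_eq]
  by_cases h : v = u + 1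
  · subst h
    have h' : u ≠ u + 1 + 1 := fun h => h2 (by linear_combination -h)
    simp [h', upEdge_levelTwist hm]
  · by_cases h' : u = v + 1
    · subst h'
      simp [h, upEdge_levelTwist hm]
    · simp [h, h']

end HamiltonCycle

/-- For `m ≥ 4`, the digraph `C_m*[2]` has a factorization into `r` `K_2*`-factors and
`s` `C⃗_{2m}`-factors for every `r ∈ {0, 2, 4}` with `r + s = 4`. -/
theorem cycleStarBlowup_K2_C2m (m r s : ℕ) (hm : 4 ≤ m)
    (hr : r = 0 ∨ r = 2 ∨ r = 4) (hrs : r + s = 4) :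
    IsFactorization (cycleStarBlowup m)
      (fun i : Fin (r + s) => if (i : ℕ) < r then 2 else 2 * m) := by
  obtain ⟨hlong, hshort⟩ := splitsInTwo_hamAdj hm
  have hsub : ∀ x y : Fin 2 × ZMod m, hamAdj x y → (x, y) ∈ cycleStarBlowup m :=
    fun x y h => h.imp And.left And.left
  have key : ∀ a b : ℕ, SplitsInTwo (hamAdj (m := m)) a → SplitsInTwo (hamAdj (m := m)) b →
      IsFactorization (cycleStarBlowup m) ![a, a, b, b] := by
    intro a b ha hb
    refine isFactorization_of_splitsInTwo ha (hb.comap (levelTwist m)) ?_ ?_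
    · intro x y h h'
      exact ((hamAdj_levelTwist hm x y).1 h').2 h
    · intro p
      rw [hamAdj_levelTwist hm]
      have := hsub p.1 p.2
      by_cases h : hamAdj p.1 p.2
      · exact iff_of_true (this h) (Or.inl h)
      · simp [h]
  rcases hr with rfl | rfl | rfl
  · obtain rfl : s = 4 := by omega
    convert key _ _ hlong hlong using 1
    ext i
    fin_cases i <;> rfl
  · obtain rfl : s = 2 := by omega
    convert key _ _ hshort hlong using 1
    ext i
    fin_cases i <;> rfl
  · obtain rfl : s = 0 := by omega
    convert key _ _ hshort hshort using 1
    ext i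
    fin_cases i <;> rfl
end

section
/- Let m ≥ 4 be an even integer. Then the digraph Γ*_m = C*[2] ⊕ F_m*[2] has a factorization into r K_2*-factors and s C⃗_{2m}-factors for every r ∈ {0, 2, 4, 6} with r + s = 6. -/
/-- The permutation of `ZMod (2 * m)` exchanging `x` and `x + 1` for all `x` of parity `b`. -/
def parityMatching (m : ℕ) (b : ZMod 2) : Equiv.Perm (ZMod (2 * m)) :=
  Function.Involutive.toPerm
    (fun x => if ZMod.castHom (Dvd.intro m rfl) (ZMod 2) x = b then x + 1 else x - 1) <| by
      intro x
      generalize hχ : ZMod.castHom (Dvd.intro m rfl) (ZMod 2) = χ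
      by_cases h : χ x = b
      · have h' : χ (x + 1) ≠ b := by
          rw [map_add, map_one, h]
          simp
        simp only [h, h', if_true, if_false, add_sub_cancel_right]
      · have h' : χ (x - 1) = b := by
          rw [map_sub, map_one]
          revert h; generalize χ x = c; revert b c; decide
        simp only [h, h', if_true, if_false, sub_add_cancel]

theorem parityMatching_apply (m : ℕ) (b : ZMod 2) (x : ZMod (2 * m)) :
    parityMatching m b x =
      if ZMod.castHom (Dvd.intro m rfl) (ZMod 2) x = b then x + 1 else x - 1 := rfl

/-- Translation by `1` if `b = 0` and by `-1` if `b = 1`. -/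
def signedShift (m : ℕ) (b : ZMod 2) : Equiv.Perm (ZMod (2 * m)) :=
  Equiv.addRight (if b = 0 then 1 else -1)

theorem exists_parityMatching_eq (m : ℕ) {x y : ZMod (2 * m)} (h : y = x + 1 ∨ x = y + 1) :
    ∃ b, parityMatching m b x = y := by
  rcases h with rfl | rfl
  · exact ⟨_, by rw [parityMatching_apply, if_pos rfl]⟩
  · refine ⟨ZMod.castHom (Dvd.intro m rfl) (ZMod 2) y, ?_⟩
    rw [parityMatching_apply, if_neg (by simp), add_sub_cancel_right]

theorem exists_signedShift_eq (m : ℕ) {x y : ZMod (2 * m)} (h : y = x + 1 ∨ x = y + 1) :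
    ∃ b, signedShift m b x = y := by
  rcases h with rfl | rfl
  · exact ⟨0, by simp [signedShift]⟩
  · exact ⟨1, by simp [signedShift]⟩

theorem minimalPeriod_parityMatching {m : ℕ} (hm : 1 ≤ m) (b : ZMod 2) (x : ZMod (2 * m)) :
    Function.minimalPeriod (parityMatching m b) x = 2 := by
  have : Fact (1 < 2 * m) := ⟨by omega⟩
  apply Function.minimalPeriod_eq_prime
  · exact Function.Involutive.toPerm_involutive _ x
  · rw [Function.IsFixedPt, parityMatching_apply]
    split_ifs <;> simp

theorem minimalPeriod_add_right {G : Type*} [AddGroup G] (a x : G) :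
    Function.minimalPeriod (fun y => y + a) x = addOrderOf a := by
  apply Nat.dvd_antisymm
  · rw [← Function.isPeriodicPt_iff_minimalPeriod_dvd, Function.IsPeriodicPt,
      Function.IsFixedPt, add_right_iterate]
    simp [addOrderOf_nsmul_eq_zero]
  · have h := Function.isPeriodicPt_minimalPeriod (fun y => y + a) x
    rw [Function.IsPeriodicPt, Function.IsFixedPt, add_right_iterate] at h
    exact addOrderOf_dvd_of_nsmul_eq_zero (by simpa using h)

theorem minimalPeriod_signedShift (m : ℕ) (b : ZMod 2) (x : ZMod (2 * m)) :
    Function.minimalPeriod (signedShift m b) x = 2 * m := by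
  refine (minimalPeriod_add_right (if b = 0 then 1 else -1) x).trans ?_
  split_ifs
  · exact ZMod.addOrderOf_one _
  · rw [addOrderOf_neg, ZMod.addOrderOf_one]

theorem minimalPeriod_permCongr {α β : Type*} (e : α ≃ β) (g : Equiv.Perm α) (x : β) :
    Function.minimalPeriod (e.permCongr g) x = Function.minimalPeriod g (e.symm x) := by
  have h : ∀ k, ((e.permCongr g)^[k]) x = e (g^[k] (e.symm x)) := by
    intro k
    induction k with
    | zero => simp
    | succ k ih => simp [Function.iterate_succ_apply', ih]
  refine Function.minimalPeriod_eq_minimalPeriod_iff.2 fun k => ?_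
  rw [Function.IsPeriodicPt, Function.IsPeriodicPt, Function.IsFixedPt, Function.IsFixedPt, h,
    ← Equiv.eq_symm_apply]

theorem exists_divNat_eq_and_cast_eq (k : Fin 3) (b : ZMod 2) :
    ∃ i : Fin 6, i.divNat (m := 3) (n := 2) = k ∧ ((i : ℕ) : ZMod 2) = b := by
  revert k b
  decide

/-- If the arcs of a digraph of out-degree at least `6` are covered by three undirected Hamilton
cycles, each given by an enumeration of the vertices by `ZMod (2 * m)`, then for every `t` the
first `t` cycles can be split into perfect matchings and the others oriented in both ways. -/
theorem isFactorization_of_hamilton {V : Type} [Fintype V] (A : Set (V × V)) {m : ℕ} (hm : 1 ≤ m)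
    (e : Fin 3 → V ≃ ZMod (2 * m))
    (hdeg : ∀ x, ∃ N : Finset V, 6 ≤ N.card ∧ ∀ y ∈ N, (x, y) ∈ A)
    (hcov : ∀ x y, (x, y) ∈ A → ∃ k, e k y = e k x + 1 ∨ e k x = e k y + 1) (t : ℕ) :
    IsFactorization A (fun i : Fin 6 => if (i : ℕ) < 2 * t then 2 else 2 * m) := by
  classical
  let g : Fin 3 → ZMod 2 → Equiv.Perm (ZMod (2 * m)) := fun k b =>
    if (k : ℕ) < t then parityMatching m b else signedShift m b
  let f : Fin 6 → Equiv.Perm V := fun i =>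
    (e (i.divNat (m := 3) (n := 2))).symm.permCongr (g (i.divNat (m := 3) (n := 2)) (i : ℕ))
  have hf : ∀ x y, (x, y) ∈ A → ∃ i, f i x = y := by
    intro x y hxy
    obtain ⟨k, hk⟩ := hcov x y hxy
    obtain ⟨b, hb⟩ : ∃ b, g k b (e k x) = e k y := by
      by_cases h : (k : ℕ) < t
      · simpa only [g, h, if_true] using exists_parityMatching_eq m hk
      · simpa only [g, h, if_false] using exists_signedShift_eq m hk
    obtain ⟨i, rfl, rfl⟩ := exists_divNat_eq_and_cast_eq k b
    exact ⟨i, by simp only [f, Equiv.permCongr_apply, Equiv.symm_symm, hb, Equiv.symm_apply_apply]⟩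
  have key : ∀ x, Function.Injective (fun i => f i x) ∧ ∀ i, (x, f i x) ∈ A := by
    intro x
    obtain ⟨N, hN, hNA⟩ := hdeg x
    have hsub : N ⊆ Finset.univ.image (fun i => f i x) := by
      intro y hy
      obtain ⟨i, hi⟩ := hf x y (hNA y hy)
      exact Finset.mem_image.2 ⟨i, Finset.mem_univ _, hi⟩
    have hle : (Finset.univ.image (fun i => f i x)).card ≤ 6 :=
      Finset.card_image_le.trans (by simp)
    have heq := Finset.eq_of_subset_of_card_le hsub (hle.trans hN)
    constructor
    · have : (Finset.univ.image (fun i => f i x)).card = (Finset.univ : Finset (Fin 6)).card := by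
        rw [← heq, Finset.card_univ, Fintype.card_fin]
        rw [← heq] at hle
        omega
      simpa [Set.injOn_univ] using Finset.card_image_iff.1 this
    · intro i
      apply hNA
      rw [heq]
      exact Finset.mem_image_of_mem _ (Finset.mem_univ i)
  refine ⟨f, ?_, fun i j x h => (key x).1 h, fun p => ⟨fun hp => hf p.1 p.2 hp, ?_⟩⟩
  · intro i x
    simp only [f, minimalPeriod_permCongr, g]
    have hi : ((i.divNat (m := 3) (n := 2) : Fin 3) : ℕ) = (i : ℕ) / 2 := rfl
    by_cases h : (i : ℕ) / 2 < t
    · rw [hi, if_pos h, if_pos (by omega), minimalPeriod_parityMatching hm]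
    · rw [hi, if_neg h, if_neg (by omega), minimalPeriod_signedShift]
  · rintro ⟨i, hi⟩
    have := (key p.1).2 i
    rwa [hi] at this

/-- Position of the vertex `(a, v)` on the first Hamilton cycle, which makes no use of
`F_{2n}[2]`. -/
def rankA (n a v : ℕ) : ℕ :=
  if v = 0 then (if a = 0 then 0 else 2 * n)
  else if v < n then (if (a + v) % 2 = 1 then v else 2 * n - v)
  else if v = n then (if a = 0 then n else 3 * n)
  else (if a = 0 then 2 * n + v else 4 * n - v)

/-- Position of the vertex `(a, v)` on the second Hamilton cycle. -/
def rankB (n a v : ℕ) : ℕ :=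
  if v = 0 then (if a = 0 then n + 1 else 0)
  else if v < n then (if a = 0 then v else n + 3 * v)
  else if v = n then (if a = 0 then 4 * n - 1 else n)
  else (if a = 0 then 7 * n - 3 * v + 1 else 7 * n - 3 * v - 1)

/-- Position of the vertex `(a, v)` on the third Hamilton cycle. -/
def rankC (n a v : ℕ) : ℕ :=
  if v = n then rankB n a v else rankB n (1 - a) v

/-- The three Hamilton cycles of `C_{2n}[2] ⊕ F_{2n}[2]`. -/
def rank (n : ℕ) : Fin 3 → ℕ → ℕ → ℕ := ![rankA n, rankB n, rankC n]

theorem rankA_inj {n a v b w : ℕ} (ha : a < 2) (hb : b < 2) (hv : v < 2 * n) (hw : w < 2 * n)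
    (h : rankA n a v = rankA n b w) : a = b ∧ v = w := by
  unfold rankA at h
  split_ifs at h <;> omega

theorem rankB_inj {n a v b w : ℕ} (ha : a < 2) (hb : b < 2) (hv : v < 2 * n) (hw : w < 2 * n)
    (h : rankB n a v = rankB n b w) : a = b ∧ v = w := by
  unfold rankB at h
  split_ifs at h <;> omega

theorem rankC_inj {n a v b w : ℕ} (ha : a < 2) (hb : b < 2) (hv : v < 2 * n) (hw : w < 2 * n)
    (h : rankC n a v = rankC n b w) : a = b ∧ v = w := by
  unfold rankC rankB at h
  split_ifs at h <;> omega

theorem rank_inj {n a v b w : ℕ} (k : Fin 3) (ha : a < 2) (hb : b < 2) (hv : v < 2 * n)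
    (hw : w < 2 * n) (h : rank n k a v = rank n k b w) : a = b ∧ v = w := by
  fin_cases k
  · exact rankA_inj ha hb hv hw h
  · exact rankB_inj ha hb hv hw h
  · exact rankC_inj ha hb hv hw h

theorem rank_lt {n a v : ℕ} (k : Fin 3) (ha : a < 2) (hv : v < 2 * n) :
    rank n k a v < 4 * n := by
  fin_cases k
  · change rankA n a v < 4 * n
    unfold rankA
    split_ifs <;> omega
  · change rankB n a v < 4 * n
    unfold rankB
    split_ifs <;> omega
  · change rankC n a v < 4 * n
    unfold rankC rankB
    split_ifs <;> omega

/-- `q` follows `p` cyclically modulo `N`. -/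
def CyclicSucc (N p q : ℕ) : Prop := q = p + 1 ∨ (q = 0 ∧ p + 1 = N)

theorem exists_rank_consecutive_of_cycle {n a b v w : ℕ} (hn : 2 ≤ n) (ha : a < 2) (hb : b < 2)
    (hv : v < 2 * n) (hw : w < 2 * n) (h : CyclicSucc (2 * n) v w) :
    ∃ k, CyclicSucc (4 * n) (rank n k a v) (rank n k b w) ∨
      CyclicSucc (4 * n) (rank n k b w) (rank n k a v) := by
  suffices (CyclicSucc (4 * n) (rankA n a v) (rankA n b w) ∨
      CyclicSucc (4 * n) (rankA n b w) (rankA n a v)) ∨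
      (CyclicSucc (4 * n) (rankB n a v) (rankB n b w) ∨
      CyclicSucc (4 * n) (rankB n b w) (rankB n a v)) ∨
      (CyclicSucc (4 * n) (rankC n a v) (rankC n b w) ∨
      CyclicSucc (4 * n) (rankC n b w) (rankC n a v)) by
    rcases this with h | h | h
    exacts [⟨0, h⟩, ⟨1, h⟩, ⟨2, h⟩]
  have hcases : (v = 0 ∧ w = 1) ∨ (0 < v ∧ w < n ∧ w = v + 1) ∨
      (0 < v ∧ v < n ∧ w = n ∧ n = v + 1) ∨
      (v = n ∧ w = n + 1) ∨ (n < v ∧ w = v + 1) ∨ (n < v ∧ w = 0 ∧ v + 1 = 2 * n) := by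
    unfold CyclicSucc at h
    omega
  clear h
  unfold CyclicSucc rankC rankB rankA
  rcases hcases with ⟨rfl, rfl⟩ | ⟨h0, h1, rfl⟩ | ⟨h0, h1, rfl, h2⟩ | ⟨rfl, rfl⟩ | ⟨h0, rfl⟩ |
    ⟨h0, rfl, h1⟩
  · simp only [show (1 : ℕ) ≠ 0 by omega, show 1 < n by omega, show (0 : ℕ) ≠ n by omega,
      show (1 : ℕ) ≠ n by omega, if_true, if_false]
    interval_cases a <;> interval_cases b <;> simp <;> omega
  · simp only [show v ≠ 0 by omega, show v < n by omega, show v ≠ n by omega,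
      show v + 1 ≠ 0 by omega, h1, show v + 1 ≠ n by omega, if_true, if_false]
    interval_cases a <;> interval_cases b <;> simp <;> split_ifs <;> omega
  · simp only [show v ≠ 0 by omega, h1, show v ≠ w by omega,
      show w ≠ 0 by omega, lt_irrefl, if_true, if_false]
    interval_cases a <;> interval_cases b <;> simp <;> split_ifs <;> omega
  · simp only [show v ≠ 0 by omega, show v + 1 ≠ 0 by omega, show ¬ v + 1 < v by omega,
      show v + 1 ≠ v by omega, lt_irrefl, if_true, if_false]
    interval_cases a <;> interval_cases b <;> simp <;> omega
  · simp only [show v ≠ 0 by omega, show ¬ v < n by omega, show v ≠ n by omega,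
      show v + 1 ≠ 0 by omega, show ¬ v + 1 < n by omega, show v + 1 ≠ n by omega,
      if_false]
    interval_cases a <;> interval_cases b <;> simp <;> omega
  · simp only [show v ≠ 0 by omega, show ¬ v < n by omega, show v ≠ n by omega,
      show 0 ≠ n by omega, if_true, if_false]
    interval_cases a <;> interval_cases b <;> simp <;> omega

theorem exists_rank_consecutive_of_factor {n a b v w : ℕ} (hn : 2 ≤ n) (ha : a < 2) (hb : b < 2)
    (h : v = 0 ∧ w = n ∨ 0 < v ∧ v < n ∧ w + v = 2 * n) :
    ∃ k, CyclicSucc (4 * n) (rank n k a v) (rank n k b w) ∨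
      CyclicSucc (4 * n) (rank n k b w) (rank n k a v) := by
  suffices (CyclicSucc (4 * n) (rankB n a v) (rankB n b w) ∨
      CyclicSucc (4 * n) (rankB n b w) (rankB n a v)) ∨
      (CyclicSucc (4 * n) (rankC n a v) (rankC n b w) ∨
      CyclicSucc (4 * n) (rankC n b w) (rankC n a v)) by
    rcases this with h | h
    exacts [⟨1, h⟩, ⟨2, h⟩]
  unfold CyclicSucc rankC rankB
  rcases h with ⟨rfl, rfl⟩ | ⟨h0, h1, h2⟩
  · simp only [show w ≠ 0 by omega, show 0 ≠ w by omega, lt_irrefl, if_true, if_false]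
    interval_cases a <;> interval_cases b <;> simp <;> omega
  · simp only [show v ≠ 0 by omega, h1, show v ≠ n by omega, show w ≠ 0 by omega,
      show ¬ w < n by omega, show w ≠ n by omega, if_true, if_false]
    interval_cases a <;> interval_cases b <;> simp <;> omega

theorem ZMod.eq_add_one_iff_cyclicSucc {N : ℕ} (hN : 2 ≤ N) (x y : ZMod N) :
    y = x + 1 ↔ CyclicSucc N x.val y.val := by
  have : NeZero N := ⟨by omega⟩
  have : Fact (1 < N) := ⟨by omega⟩
  have hx := x.val_lt
  have hy := y.val_lt
  rw [← (ZMod.val_injective N).eq_iff, ZMod.val_add, ZMod.val_one, CyclicSucc]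
  rcases Nat.lt_or_ge (x.val + 1) N with h | h
  · rw [Nat.mod_eq_of_lt h]; omega
  · rw [show x.val + 1 = N by omega, Nat.mod_self]; omega

theorem mem_FStarBlowup_iff {n : ℕ} (hn : 2 ≤ n)
    (p : (Fin 2 × ZMod (2 * n)) × (Fin 2 × ZMod (2 * n))) :
    p ∈ FStarBlowup (2 * n) ↔
      (p.1.2.val = 0 ∧ p.2.2.val = n) ∨ (p.1.2.val = n ∧ p.2.2.val = 0) ∨
        (p.1.2.val ≠ 0 ∧ p.1.2.val ≠ n ∧ p.2.2.val + p.1.2.val = 2 * n) := by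
  have : NeZero (2 * n) := ⟨by omega⟩
  obtain ⟨⟨a, u⟩, ⟨b, w⟩⟩ := p
  have hu := u.val_lt
  have hw := w.val_lt
  have hz : ∀ x : ZMod (2 * n), x = 0 ↔ x.val = 0 := fun x => (ZMod.val_eq_zero x).symm
  have hh : ∀ x : ZMod (2 * n), x = ((2 * n / 2 : ℕ) : ZMod (2 * n)) ↔ x.val = n := by
    intro x
    rw [← (ZMod.val_injective (2 * n)).eq_iff, ZMod.val_natCast, Nat.mod_eq_of_lt (by omega)]
    omega
  have hneg : w = -u ↔ w.val = if u.val = 0 then 0 else 2 * n - u.val := by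
    rw [← (ZMod.val_injective (2 * n)).eq_iff, ZMod.neg_val]
    simp only [hz]
  simp only [FStarBlowup, Set.mem_ofPred_eq, hneg, hh, ne_eq, hz]
  split_ifs <;> omega

theorem exists_rank_consecutive {n : ℕ} (hn : 2 ≤ n) (x y : Fin 2 × ZMod (2 * n))
    (h : (x, y) ∈ GammaStar (2 * n)) :
    ∃ k, CyclicSucc (4 * n) (rank n k x.1 x.2.val) (rank n k y.1 y.2.val) ∨
      CyclicSucc (4 * n) (rank n k y.1 y.2.val) (rank n k x.1 x.2.val) := by
  have : NeZero (2 * n) := ⟨by omega⟩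
  have hx := x.2.val_lt
  have hy := y.2.val_lt
  rcases h with (h | h) | h
  · rw [ZMod.eq_add_one_iff_cyclicSucc (by omega)] at h
    exact exists_rank_consecutive_of_cycle hn x.1.2 y.1.2 hx hy h
  · rw [ZMod.eq_add_one_iff_cyclicSucc (by omega)] at h
    obtain ⟨k, hk⟩ := exists_rank_consecutive_of_cycle hn y.1.2 x.1.2 hy hx h
    exact ⟨k, hk.symm⟩
  · rw [mem_FStarBlowup_iff hn] at h
    dsimp only at h
    by_cases hc : x.2.val = 0 ∧ y.2.val = n ∨ 0 < x.2.val ∧ x.2.val < n ∧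
        y.2.val + x.2.val = 2 * n
    · exact exists_rank_consecutive_of_factor hn x.1.2 y.1.2 hc
    · obtain ⟨k, hk⟩ := exists_rank_consecutive_of_factor (a := y.1) (b := x.1) (v := y.2.val)
        (w := x.2.val) hn y.1.2 x.1.2 (by omega)
      exact ⟨k, hk.symm⟩

theorem exists_six_outNeighbors {n : ℕ} (hn : 2 ≤ n) (x : Fin 2 × ZMod (2 * n)) :
    ∃ N : Finset (Fin 2 × ZMod (2 * n)), 6 ≤ N.card ∧ ∀ y ∈ N, (x, y) ∈ GammaStar (2 * n) := by
  have : NeZero (2 * n) := ⟨by omega⟩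
  obtain ⟨w, hw⟩ : ∃ w : ZMod (2 * n), ∀ b, (x, (b, w)) ∈ FStarBlowup (2 * n) := by
    by_cases h0 : x.2 = 0
    · exact ⟨_, fun b => Or.inl ⟨h0, rfl⟩⟩
    · by_cases h1 : x.2 = ((2 * n / 2 : ℕ) : ZMod (2 * n))
      · exact ⟨_, fun b => Or.inr (Or.inl ⟨h1, rfl⟩)⟩
      · exact ⟨-x.2, fun b => Or.inr (Or.inr ⟨h0, h1, rfl⟩)⟩
  refine ⟨Finset.univ ×ˢ {x.2 + 1, x.2 - 1, w}, ?_, ?_⟩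
  · have hx := x.2.val_lt
    have hF := (mem_FStarBlowup_iff hn _).1 (hw 0)
    dsimp only at hF
    have hs := (ZMod.eq_add_one_iff_cyclicSucc (by omega) x.2 _).1 rfl
    have hp := (ZMod.eq_add_one_iff_cyclicSucc (by omega) (x.2 - 1) x.2).1 (by ring)
    unfold CyclicSucc at hs hp
    have h1 : x.2 + 1 ≠ x.2 - 1 := fun h => by rw [h] at hs; omega
    have h2 : x.2 + 1 ≠ w := fun h => by rw [h] at hs; omega
    have h3 : x.2 - 1 ≠ w := fun h => by rw [h] at hp; omega
    rw [Finset.card_product, Finset.card_eq_three.2 ⟨_, _, _, h1, h2, h3, rfl⟩]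
    simp
  · rintro ⟨b, y⟩ hy
    simp only [Finset.mem_product, Finset.mem_univ, true_and, Finset.mem_insert,
      Finset.mem_singleton] at hy
    rcases hy with rfl | rfl | rfl
    · exact Or.inl (Or.inl rfl)
    · exact Or.inl (Or.inr (sub_add_cancel _ _).symm)
    · exact Or.inr (hw b)

/-- The enumeration of the vertices along the `k`-th Hamilton cycle. -/
noncomputable def hamiltonEquiv (n : ℕ) [NeZero n] (k : Fin 3) :
    Fin 2 × ZMod (2 * n) ≃ ZMod (2 * (2 * n)) :=
  Equiv.ofBijective (fun x => (rank n k x.1 x.2.val : ZMod (2 * (2 * n)))) <| by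
    rw [Fintype.bijective_iff_injective_and_card]
    refine ⟨fun x y h => ?_, by simp [ZMod.card]⟩
    have hx := rank_lt k x.1.2 x.2.val_lt
    have hy := rank_lt k y.1.2 y.2.val_lt
    have h' := congrArg ZMod.val h
    simp only [ZMod.val_natCast] at h'
    rw [Nat.mod_eq_of_lt (by omega), Nat.mod_eq_of_lt (by omega)] at h'
    obtain ⟨h1, h2⟩ := rank_inj k x.1.2 y.1.2 x.2.val_lt y.2.val_lt h'
    exact Prod.ext (Fin.ext h1) (ZMod.val_injective _ h2)

theorem val_hamiltonEquiv (n : ℕ) [NeZero n] (k : Fin 3) (x : Fin 2 × ZMod (2 * n)) :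
    (hamiltonEquiv n k x).val = rank n k x.1 x.2.val := by
  have hx := rank_lt k x.1.2 x.2.val_lt
  exact (ZMod.val_natCast _ _).trans (Nat.mod_eq_of_lt (by omega))

/-- For even `m ≥ 4`, the digraph `Γ*_m = C*[2] ⊕ F_m*[2]` has a factorization into
`r` `K_2*`-factors and `s` `C⃗_{2m}`-factors for every `r ∈ {0, 2, 4, 6}` with
`r + s = 6`. -/
theorem gammaStar_K2_C2m (m r s : ℕ) (hm : 4 ≤ m) (hme : Even m)
    (hr : r = 0 ∨ r = 2 ∨ r = 4 ∨ r = 6) (hrs : r + s = 6) :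
    IsFactorization (GammaStar m)
      (fun i : Fin (r + s) => if (i : ℕ) < r then 2 else 2 * m) := by
  obtain ⟨n, hn⟩ := hme.exists_two_nsmul
  obtain rfl : m = 2 * n := by simpa using hn
  have : NeZero n := ⟨by omega⟩
  have key := isFactorization_of_hamilton (GammaStar (2 * n)) (by omega) (hamiltonEquiv n)
    (exists_six_outNeighbors (by omega)) fun x y h => by
      obtain ⟨k, hk⟩ := exists_rank_consecutive (by omega) x y h
      refine ⟨k, ?_⟩
      rw [ZMod.eq_add_one_iff_cyclicSucc (by omega), ZMod.eq_add_one_iff_cyclicSucc (by omega),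
        val_hamiltonEquiv, val_hamiltonEquiv, ← mul_assoc]
      exact hk
  rcases hr with rfl | rfl | rfl | rfl
  · obtain rfl : s = 6 := by omega
    exact key 0
  · obtain rfl : s = 4 := by omega
    exact key 1
  · obtain rfl : s = 2 := by omega
    exact key 2
  · obtain rfl : s = 0 := by omega
    exact key 3
end

section
/- Let m ≥ 5 be an integer. Then the digraph C_m*[2] ⊕ I*_{2m} has a factorization into r K_2*-factors and s C⃗_{2m}-factors for every r ∈ {0, 1, 3, 5} with r + s = 5. -/
/-- A self-map of a finite type admitting a `ZMod n`-valued rank that increases by one at every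
step, where `n` is the size of the type, consists of a single `n`-cycle. -/
theorem exists_perm_minimalPeriod_of_rank {V : Type} [Fintype V] {n : ℕ} [NeZero n]
    (hcard : Fintype.card V = n) (f : V → V) (ρ : V → ZMod n)
    (hρ : ∀ v, ρ (f v) = ρ v + 1) :
    ∃ σ : Equiv.Perm V, (∀ v, σ v = f v) ∧ ∀ v, Function.minimalPeriod σ v = n := by
  have hiter : ∀ (j : ℕ) (v : V), ρ (f^[j] v) = ρ v + j := by
    intro j v
    induction j with
    | zero => simp
    | succ j ih => rw [Function.iterate_succ_apply', hρ, ih]; push_cast; ring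
  have hper : ∀ v, f^[n] v = v := by
    intro v
    have hinj : Function.Injective (fun j : Fin n => f^[(j : ℕ)] v) := by
      intro i j hij
      have h := congrArg ρ hij
      simp only [hiter, add_right_inj] at h
      have h' := (ZMod.natCast_eq_natCast_iff' _ _ _).1 h
      rw [Nat.mod_eq_of_lt i.2, Nat.mod_eq_of_lt j.2] at h'
      exact Fin.ext h'
    have hsurj := ((Fintype.bijective_iff_injective_and_card _).2
      ⟨hinj, by simp [hcard]⟩).surjective
    obtain ⟨j, hj⟩ := hsurj (f^[n] v)
    have h := congrArg ρ hj
    simp only [hiter, add_right_inj] at h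
    have h' := (ZMod.natCast_eq_natCast_iff' _ _ _).1 h
    rw [Nat.mod_eq_of_lt j.2, Nat.mod_self] at h'
    simpa [h'] using hj.symm
  have hinj : Function.Injective f := by
    intro x y hxy
    have hn : n = (n - 1) + 1 := by have := NeZero.pos n; omega
    rw [← hper x, ← hper y, hn, Function.iterate_succ_apply, Function.iterate_succ_apply, hxy]
  refine ⟨Equiv.ofBijective f (Finite.injective_iff_bijective.1 hinj), fun v => rfl, fun v => ?_⟩
  change Function.minimalPeriod f v = n
  refine Nat.dvd_antisymm (Function.IsPeriodicPt.minimalPeriod_dvd (hper v)) ?_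
  have h := hiter (Function.minimalPeriod f v) v
  rw [Function.iterate_minimalPeriod] at h
  exact (ZMod.natCast_eq_zero_iff _ _).1 (by simpa using h)

theorem minimalPeriod_eq_two_s9 {V : Type} {f : V → V} (h₁ : ∀ v, f (f v) = v)
    (h₂ : ∀ v, f v ≠ v) (v : V) : Function.minimalPeriod f v = 2 :=
  Function.minimalPeriod_eq_prime (p := 2) (h₁ v) (h₂ v)

theorem minimalPeriod_symm {V : Type} (σ : Equiv.Perm V) (v : V) :
    Function.minimalPeriod σ.symm v = Function.minimalPeriod σ v := by
  have h : ∀ (τ : Equiv.Perm V), Function.minimalPeriod τ.symm v ∣ Function.minimalPeriod τ v := by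
    intro τ
    apply Function.IsPeriodicPt.minimalPeriod_dvd
    have h := Function.LeftInverse.iterate τ.symm_apply_apply (Function.minimalPeriod τ v) v
    rwa [Function.iterate_minimalPeriod] at h
  exact Nat.dvd_antisymm (h σ) (h σ.symm)

theorem ZMod.val_add_one_cases {m : ℕ} [NeZero m] (hm : 2 ≤ m) (c : ZMod m) :
    (c + 1).val = c.val + 1 ∧ c.val + 1 < m ∨ (c + 1).val = 0 ∧ c.val + 1 = m := by
  have : Fact (1 < m) := ⟨by omega⟩
  have hc := ZMod.val_lt c
  rcases Nat.lt_or_ge (c.val + 1) m with h | h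
  · left
    refine ⟨?_, h⟩
    rw [ZMod.val_add_of_lt] <;> rw [ZMod.val_one]
    exact h
  · right
    refine ⟨?_, by omega⟩
    rw [ZMod.val_add, ZMod.val_one, show c.val + 1 = m by omega, Nat.mod_self]

/-- A family of five permutations with prescribed periods whose arcs cover the given digraph is
automatically a factorization, as every vertex has exactly five out-neighbours. -/
theorem isFactorization_of_cover {m : ℕ} (hm : 3 ≤ m) (c : Fin 5 → ℕ)
    (f : Fin 5 → Equiv.Perm (Fin 2 × ZMod m))
    (hper : ∀ i x, Function.minimalPeriod (⇑(f i)) x = c i)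
    (hcover : ∀ u v, (u, v) ∈ cycleStarBlowup m ∪ IStar m → ∃ i, f i u = v) :
    IsFactorization (cycleStarBlowup m ∪ IStar m) c := by
  have : Fact (1 < m) := ⟨by omega⟩
  have key : ∀ u, Function.Injective (fun i => f i u) ∧
      ∀ i, (u, f i u) ∈ cycleStarBlowup m ∪ IStar m := by
    rintro ⟨a, c⟩
    let g : Fin 5 → Fin 2 × ZMod m :=
      ![(0, c + 1), (1, c + 1), (0, c - 1), (1, c - 1), (a + 1, c)]
    have hgA : ∀ j, ((a, c), g j) ∈ cycleStarBlowup m ∪ IStar m := by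
      have ha : a ≠ a + 1 := by revert a; decide
      intro j
      fin_cases j <;> simp [g, cycleStarBlowup, IStar, ha]
    have h1 : (1 : ZMod m) ≠ 0 := one_ne_zero
    have h2 : (1 : ZMod m) + 1 ≠ 0 := by
      intro h
      have h' : ((2 : ℕ) : ZMod m) = 0 := by push_cast; rw [← h]; norm_num
      have := Nat.le_of_dvd (by norm_num) ((ZMod.natCast_eq_zero_iff _ _).1 h')
      omega
    have h3 : c + 1 ≠ c - 1 := fun h => h2 (by linear_combination h)
    have h4 : c + 1 ≠ c := fun h => h1 (by linear_combination h)
    have h5 : c - 1 ≠ c := fun h => h1 (by linear_combination -h)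
    have hginj : Function.Injective g := by
      intro i j hij
      fin_cases i <;> fin_cases j <;>
        simp [g, h3, h4, h5, h3.symm, h4.symm, h5.symm] at hij ⊢
    choose t ht using fun j => hcover _ _ (hgA j)
    have htinj : Function.Injective t := fun i j hij => hginj (by rw [← ht, ← ht, hij])
    have htsurj := Finite.surjective_of_injective htinj
    refine ⟨fun i j hij => ?_, fun i => ?_⟩
    · obtain ⟨i, rfl⟩ := htsurj i
      obtain ⟨j, rfl⟩ := htsurj j
      simp only [ht] at hij
      rw [hginj hij]
    · obtain ⟨i, rfl⟩ := htsurj i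
      rw [ht]
      exact hgA i
  refine ⟨f, hper, fun i j x h => (key x).1 h, fun p => ⟨hcover p.1 p.2, ?_⟩⟩
  rintro ⟨i, hi⟩
  have := (key p.1).2 i
  rwa [hi] at this

/-- Splitting a cycle of even length into two perfect matchings. -/
theorem exists_matchings {V : Type} {n : ℕ} (σ : Equiv.Perm V) (ρ : V → ZMod (2 * n))
    (hρ : ∀ v, ρ (σ v) = ρ v + 1) :
    ∃ μ ν : Equiv.Perm V, (∀ v, Function.minimalPeriod μ v = 2) ∧
      (∀ v, Function.minimalPeriod ν v = 2) ∧
      ∀ v, (μ v = σ v ∧ ν v = σ.symm v) ∨ (μ v = σ.symm v ∧ ν v = σ v) := by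
  let π : V → ZMod 2 := fun v => ZMod.castHom (Dvd.intro n rfl) (ZMod 2) (ρ v)
  have hπ : ∀ v, π (σ v) = π v + 1 := fun v => by simp [π, hρ]
  have hπ' : ∀ v, π (σ.symm v) = π v + 1 := fun v => by
    have h := hπ (σ.symm v)
    rw [Equiv.apply_symm_apply] at h
    rw [h, add_assoc, show (1 : ZMod 2) + 1 = 0 from rfl, add_zero]
  have main : ∀ z : ZMod 2, ∃ μ : Equiv.Perm V, (∀ v, Function.minimalPeriod μ v = 2) ∧
      ∀ v, μ v = if π v = z then σ v else σ.symm v := by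
    intro z
    let μ : V → V := fun v => if π v = z then σ v else σ.symm v
    have hne : ∀ y : ZMod 2, y + 1 ≠ y := by decide
    have hz : ∀ y : ZMod 2, y ≠ z → y + 1 = z := by revert z; decide
    have hμ : ∀ v, μ (μ v) = v := by
      intro v
      by_cases h : π v = z
      · simp [μ, h, hπ, hne]
      · simp [μ, h, hπ', hz _ h]
    have hμ' : ∀ v, μ v ≠ v := by
      intro v h
      have h' : π (μ v) = π v + 1 := by
        by_cases h : π v = z
        · simp [μ, h, hπ]
        · simp [μ, h, hπ']
      rw [h] at h'
      exact hne _ h'.symm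
    exact ⟨Function.Involutive.toPerm μ hμ, minimalPeriod_eq_two_s9 hμ hμ', fun v => rfl⟩
  obtain ⟨μ, hμ, hμ'⟩ := main 0
  obtain ⟨ν, hν, hν'⟩ := main 1
  refine ⟨μ, ν, hμ, hν, fun v => ?_⟩
  have h01 : ∀ y : ZMod 2, y = 0 ∨ y = 1 := by decide
  rcases h01 (π v) with h | h
  · left; simp [hμ', hν', h]
  · right; simp [hμ', hν', h]

/-- The Hamiltonian cycle of the blown-up `m`-cycle that goes once around through the vertices
`(p c, c)`, and then back through the remaining vertices `(p c + 1, c)`. -/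
theorem exists_there_and_back {m : ℕ} (hm : 3 ≤ m) (p : ZMod m → Fin 2) :
    ∃ (σ : Equiv.Perm (Fin 2 × ZMod m)) (ρ : Fin 2 × ZMod m → ZMod (2 * m)),
      (∀ v, ρ (σ v) = ρ v + 1) ∧ (∀ v, Function.minimalPeriod σ v = 2 * m) ∧
      ∀ a b c, (c = 0 ∧ a = p 0 ∨ c + 1 = 0 ∧ b = p 0 + 1 ∨
          c ≠ 0 ∧ c + 1 ≠ 0 ∧ b + a = p (c + 1) + p c) →
        σ (a, c) = (b, c + 1) ∨ σ (b, c + 1) = (a, c) := by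
  have : NeZero m := ⟨by omega⟩
  have : NeZero (2 * m) := ⟨by omega⟩
  have : Fact (1 < m) := ⟨by omega⟩
  let f : Fin 2 × ZMod m → Fin 2 × ZMod m := fun v =>
    if v.1 = p v.2 then (if v.2 + 1 = 0 then p 0 + 1 else p (v.2 + 1), v.2 + 1)
    else (if v.2 = 1 then p 0 else p (v.2 - 1) + 1, v.2 - 1)
  let ρ : Fin 2 × ZMod m → ℕ := fun v =>
    if v.1 = p v.2 then v.2.val else if v.2 = 0 then m else 2 * m - v.2.val
  have hF : ∀ x : Fin 2, x + 1 ≠ x := by decide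
  have hF' : ∀ x y : Fin 2, x ≠ y → x = y + 1 := by decide
  have hval : ∀ c : ZMod m, c = 0 ↔ c.val = 0 := fun c => (ZMod.val_eq_zero c).symm
  have hρ : ∀ v, ρ (f v) = ρ v + 1 ∨ ρ (f v) + 2 * m = ρ v + 1 := by
    rintro ⟨a, c⟩
    by_cases ha : a = p c
    · subst ha
      rcases ZMod.val_add_one_cases (by omega) c with ⟨h1, h2⟩ | ⟨h1, h2⟩
      · have h0 : c + 1 ≠ 0 := by rw [ne_eq, hval]; omega
        simp [f, ρ, h0, h1]
      · have h0 : c + 1 = 0 := by rw [hval]; omega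
        simp [f, ρ, h0, hF, h2]
    · obtain ⟨d, rfl⟩ : ∃ d, c = d + 1 := ⟨c - 1, by ring⟩
      have h2m := ZMod.val_lt d
      by_cases hd : d = 0
      · subst hd
        have : (1 : ZMod m).val = 1 := ZMod.val_one m
        rw [zero_add] at ha
        right
        simp [f, ρ, ha, this]
        omega
      · have hd' := hd
        rw [hval] at hd'
        left
        rcases ZMod.val_add_one_cases (by omega) d with ⟨h1, h2⟩ | ⟨h1, h2⟩
        · have h0 : d + 1 ≠ 0 := by rw [ne_eq, hval]; omega
          simp [f, ρ, h0, h1, ha, hF, hd]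
          omega
        · have h0 : d + 1 = 0 := by rw [hval]; omega
          have h3 : f (a, d + 1) = (p d + 1, d) := by simp [f, ha, hd]
          rw [h3]
          simp [ρ, ha, hF, hd]
          simp [h0]
          omega
  have hρ' : ∀ v, ((ρ (f v) : ℕ) : ZMod (2 * m)) = (ρ v : ℕ) + 1 := by
    intro v
    rcases hρ v with h | h
    · rw [h]; push_cast; rfl
    · have h' := congrArg (Nat.cast (R := ZMod (2 * m))) h
      rwa [Nat.cast_add, ZMod.natCast_self, add_zero, Nat.cast_add, Nat.cast_one] at h'
  obtain ⟨σ, hσ, hper⟩ := exists_perm_minimalPeriod_of_rank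
    (by simp [ZMod.card]) f (fun v => ((ρ v : ℕ) : ZMod (2 * m))) hρ'
  refine ⟨σ, fun v => ((ρ v : ℕ) : ZMod (2 * m)), fun v => by rw [hσ]; exact hρ' v, hper, ?_⟩
  intro a b c h
  rw [hσ, hσ]
  rcases h with ⟨rfl, rfl⟩ | ⟨h0, rfl⟩ | ⟨h0, h1, h⟩
  · by_cases hb : b = p (0 + 1)
    · left; subst hb; simp [f]
    · right; rw [zero_add] at hb; simp [f, hb]
  · by_cases ha : a = p c
    · left; subst ha; simp [f, h0]
    · right
      have hc : c ≠ 0 := by rintro rfl; simp at h0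
      simp only [f, h0, hF, if_false, zero_ne_one, Prod.mk.injEq]
      rw [← h0, add_sub_cancel_right]
      exact ⟨(hF' _ _ ha).symm, rfl⟩
  · have hF₂ : ∀ x y z w : Fin 2, w + x = z + y → (x = y ∧ w = z) ∨ (x = y + 1 ∧ w = z + 1) := by
      decide
    rcases hF₂ _ _ _ _ h with ⟨rfl, rfl⟩ | ⟨rfl, rfl⟩
    · left; simp [f, h1]
    · right; simp [f, hF, h0]

/-- Two Hamiltonian cycles which together use every edge of the blown-up `m`-cycle once. -/
theorem exists_hamiltonian_pair {m : ℕ} (hm : 3 ≤ m) :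
    ∃ (σ τ : Equiv.Perm (Fin 2 × ZMod m)) (ρ ρ' : Fin 2 × ZMod m → ZMod (2 * m)),
      ((∀ v, ρ (σ v) = ρ v + 1) ∧ ∀ v, Function.minimalPeriod σ v = 2 * m) ∧
      ((∀ v, ρ' (τ v) = ρ' v + 1) ∧ ∀ v, Function.minimalPeriod τ v = 2 * m) ∧
      ∀ u v, (u, v) ∈ cycleStarBlowup m →
        σ u = v ∨ σ.symm u = v ∨ τ u = v ∨ τ.symm u = v := by
  have : NeZero m := ⟨by omega⟩
  obtain ⟨σ, ρ, hσ, hσ', hcσ⟩ := exists_there_and_back hm (fun _ => 0)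
  obtain ⟨τ, ρ', hτ, hτ', hcτ⟩ := exists_there_and_back hm (fun c => Fin.ofNat 2 (c.val + 1))
  refine ⟨σ, τ, ρ, ρ', ⟨hσ, hσ'⟩, ⟨hτ, hτ'⟩, ?_⟩
  have key : ∀ a b c, (σ (a, c) = (b, c + 1) ∨ σ (b, c + 1) = (a, c)) ∨
      (τ (a, c) = (b, c + 1) ∨ τ (b, c + 1) = (a, c)) := by
    intro a b c
    by_cases h0 : c = 0
    · have : a = 0 ∨ a = 1 := by revert a; decide
      rcases this with ha | ha
      · exact Or.inl (hcσ a b c (by simp [h0, ha]))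
      · exact Or.inr (hcτ a b c (by simp [h0, ha]))
    · by_cases h1 : c + 1 = 0
      · have : b = 0 ∨ b = 1 := by revert b; decide
        rcases this with hb | hb
        · exact Or.inr (hcτ a b c (by simp [h1, hb]))
        · exact Or.inl (hcσ a b c (by simp [h1, hb]))
      · have hv : (c + 1).val = c.val + 1 := by
          rcases ZMod.val_add_one_cases (by omega) c with h | h
          · exact h.1
          · exact absurd ((ZMod.val_eq_zero _).1 h.1) h1
        have hF : ∀ a b x : Fin 2, b + a = 0 ∨ b + a = (x + 1) + x := by decide
        have hq : Fin.ofNat 2 (c.val + 1 + 1) = Fin.ofNat 2 (c.val + 1) + 1 := by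
          ext; simp [Fin.val_add]
        rcases hF a b (Fin.ofNat 2 (c.val + 1)) with h | h
        · exact Or.inl (hcσ a b c (by simp [h0, h1, h]))
        · exact Or.inr (hcτ a b c (Or.inr (Or.inr ⟨h0, h1, by
            rw [hv, h, hq]⟩)))
  rintro ⟨a, c⟩ ⟨b, d⟩ h
  simp only [cycleStarBlowup, Set.mem_ofPred_eq] at h
  rcases h with rfl | rfl
  · rcases key a b c with (h | h) | (h | h)
    · exact Or.inl h
    · exact Or.inr (Or.inl (by rw [← h, Equiv.symm_apply_apply]))
    · exact Or.inr (Or.inr (Or.inl h))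
    · exact Or.inr (Or.inr (Or.inr (by rw [← h, Equiv.symm_apply_apply])))
  · rcases key b a d with (h | h) | (h | h)
    · exact Or.inr (Or.inl (by rw [← h, Equiv.symm_apply_apply]))
    · exact Or.inl h
    · exact Or.inr (Or.inr (Or.inr (by rw [← h, Equiv.symm_apply_apply])))
    · exact Or.inr (Or.inr (Or.inl h))

/-- The column type of column `c`: columns below `N` are their own type, and the later ones
alternate between the types `N` and `N + 1`. -/
def columnType (N c : ℕ) : ℕ := if c < N then c else N + (c - N) % 2

/-- `affineEval p q k` is the value of the affine form `p` in the block number `q` and the number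
`k` of blocks. -/
def affineEval (p : ℤ × ℤ × ℤ) (q k : ℤ) : ℤ := p.1 + p.2.1 * q + p.2.2 * k

/-- The affine form `p` restricted to block number `0`. -/
def atFirst (p : ℤ × ℤ × ℤ) : ℤ × ℤ × ℤ := (p.1, 0, p.2.2)

/-- The affine form `p` restricted to block number `k - 1`. -/
def atLast (p : ℤ × ℤ × ℤ) : ℤ × ℤ × ℤ := (p.1 - p.2.1, 0, p.2.2 + p.2.1)

/-- The affine form `p` with the block number increased by one. -/
def atNext (p : ℤ × ℤ × ℤ) : ℤ × ℤ × ℤ := (p.1 + p.2.1, p.2.1, p.2.2)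

/-- The affine form `p` with no blocks. -/
def atEmpty (p : ℤ × ℤ × ℤ) : ℤ × ℤ × ℤ := (p.1, 0, 0)

/-- `p'` is `p + 1` up to possibly one subtraction of `w`. -/
def IsNextRank (w p p' : ℤ × ℤ × ℤ) : Prop := p' = p + (1, 0, 0) ∨ p' + w = p + (1, 0, 0)

instance (w p p' : ℤ × ℤ × ℤ) : Decidable (IsNextRank w p p') :=
  inferInstanceAs (Decidable (_ ∨ _))

/-- Along every arc of the table `T` between adjacent columns of types `x` and `y` the rank `ρ`
increases by one modulo `w`; here `s` and `t` express the ranks in the two columns through a common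
block number. -/
def IsLinked (T : Fin 2 → ℕ → Fin 2 × ℤ) (ρ : Fin 2 → ℕ → ℤ × ℤ × ℤ) (w : ℤ × ℤ × ℤ) (x y : ℕ)
    (s t : ℤ × ℤ × ℤ → ℤ × ℤ × ℤ) : Prop :=
  ∀ a, ((T a x).2 = 1 → IsNextRank w (s (ρ a x)) (t (ρ (T a x).1 y))) ∧
    ((T a y).2 = -1 → IsNextRank w (t (ρ a y)) (s (ρ (T a y).1 x)))

instance (T : Fin 2 → ℕ → Fin 2 × ℤ) (ρ : Fin 2 → ℕ → ℤ × ℤ × ℤ) (w : ℤ × ℤ × ℤ) (x y : ℕ)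
    (s t : ℤ × ℤ × ℤ → ℤ × ℤ × ℤ) : Decidable (IsLinked T ρ w x y s t) :=
  inferInstanceAs (Decidable (∀ _, _))

/-- The affine ranks `ρ` certify that the table `T`, which lists for every row and every column type
the row of the successor and the column offset to it, describes a Hamiltonian cycle of the blown-up
cycle on `N + 2 * k` columns for every `k`. -/
def IsHamiltonianTable (N : ℕ) (T : Fin 2 → ℕ → Fin 2 × ℤ) (ρ : Fin 2 → ℕ → ℤ × ℤ × ℤ) : Prop :=
  (∀ a, ∀ x < N + 2, ((T a x).2 = 0 ∧ IsNextRank (2 * N, 0, 4) (ρ a x) (ρ (T a x).1 x)) ∨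
    (T a x).2 = 1 ∨ (T a x).2 = -1) ∧
  (∀ x < N, IsLinked T ρ (2 * N, 0, 4) x (x + 1) atFirst atFirst) ∧
  IsLinked T ρ (2 * N, 0, 4) N (N + 1) id id ∧
  IsLinked T ρ (2 * N, 0, 4) (N + 1) N id atNext ∧
  IsLinked T ρ (2 * N, 0, 4) (N + 1) 0 atLast atFirst ∧
  IsLinked T ρ (2 * N, 0, 0) (N - 1) 0 atEmpty atEmpty

instance (N : ℕ) (T : Fin 2 → ℕ → Fin 2 × ℤ) (ρ : Fin 2 → ℕ → ℤ × ℤ × ℤ) :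
    Decidable (IsHamiltonianTable N T ρ) :=
  inferInstanceAs (Decidable (_ ∧ _))

theorem affineEval_atFirst (p : ℤ × ℤ × ℤ) (q k : ℤ) :
    affineEval (atFirst p) q k = affineEval p 0 k := by
  simp [affineEval, atFirst]

theorem affineEval_atLast (p : ℤ × ℤ × ℤ) (q k : ℤ) :
    affineEval (atLast p) q k = affineEval p (k - 1) k := by
  simp only [affineEval, atLast]; ring

theorem affineEval_atNext (p : ℤ × ℤ × ℤ) (q k : ℤ) :
    affineEval (atNext p) q k = affineEval p (q + 1) k := by
  simp only [affineEval, atNext]; ring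

theorem affineEval_atEmpty (p : ℤ × ℤ × ℤ) (q : ℤ) :
    affineEval (atEmpty p) q 0 = affineEval p 0 0 := by
  simp [affineEval, atEmpty]

theorem IsNextRank.affineEval_cast {w p p' : ℤ × ℤ × ℤ} (h : IsNextRank w p p') {n : ℕ} {q k : ℤ}
    (hw : affineEval w q k = n) :
    (affineEval p' q k : ZMod n) = (affineEval p q k : ZMod n) + 1 := by
  have hadd : ∀ u v : ℤ × ℤ × ℤ, affineEval (u + v) q k = affineEval u q k + affineEval v q k := by
    intro u v; simp only [affineEval, Prod.fst_add, Prod.snd_add]; ring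
  have hone : affineEval (1, 0, 0) q k = 1 := by simp [affineEval]
  rcases h with h | h
  · rw [h, hadd, hone]; push_cast; rfl
  · have h' := congrArg (fun p => ((affineEval p q k : ℤ) : ZMod n)) h
    simpa [hadd, hone, hw] using h'

/-- The successor function described by a table. -/
def tableStep (N m : ℕ) (T : Fin 2 → ℕ → Fin 2 × ℤ) (v : Fin 2 × ZMod m) : Fin 2 × ZMod m :=
  ((T v.1 (columnType N v.2.val)).1, v.2 + ((T v.1 (columnType N v.2.val)).2 : ZMod m))

theorem IsHamiltonianTable.exists_perm {N k m : ℕ} {T : Fin 2 → ℕ → Fin 2 × ℤ}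
    {ρ : Fin 2 → ℕ → ℤ × ℤ × ℤ} (h : IsHamiltonianTable N T ρ) (hN : 2 ≤ N)
    (hm : m = N + 2 * k) :
    ∃ σ : Equiv.Perm (Fin 2 × ZMod m), (∀ v, σ v = tableStep N m T v) ∧
      ∀ v, Function.minimalPeriod σ v = 2 * m := by
  have : NeZero m := ⟨by omega⟩
  have : NeZero (2 * m) := ⟨by omega⟩
  obtain ⟨h₀, hspecial, hblock, hnext, hlast, hempty⟩ := h
  let R : Fin 2 → ℕ → ℤ := fun a c => affineEval (ρ a (columnType N c)) ((c - N) / 2 : ℕ) k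
  have hw : ∀ q : ℤ, affineEval (2 * N, 0, 4) q k = (2 * m : ℕ) := by
    intro q; simp only [affineEval, hm]; push_cast; ring
  have hlink : ∀ c c' x y : ℕ, ∀ w s t, ∀ q : ℤ, IsLinked T ρ w x y s t →
      affineEval w q k = (2 * m : ℕ) → columnType N c = x → columnType N c' = y →
      (∀ p, affineEval (s p) q k = affineEval p ((c - N) / 2 : ℕ) k) →
      (∀ p, affineEval (t p) q k = affineEval p ((c' - N) / 2 : ℕ) k) →
      ∀ a, ((T a (columnType N c)).2 = 1 →
          (R (T a (columnType N c)).1 c' : ZMod (2 * m)) = R a c + 1) ∧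
        ((T a (columnType N c')).2 = -1 →
          (R (T a (columnType N c')).1 c : ZMod (2 * m)) = R a c' + 1) := by
    intro c c' x y w s t q hl hw hx hy hs ht a
    subst hx hy
    refine ⟨fun ha => ?_, fun ha => ?_⟩
    · have := ((hl a).1 ha).affineEval_cast hw
      rwa [hs, ht] at this
    · have := ((hl a).2 ha).affineEval_cast hw
      rwa [hs, ht] at this
  have hadj : ∀ c c' : ℕ, (c' = c + 1 ∧ c + 1 < m ∨ c' = 0 ∧ c + 1 = m) →
      ∀ a, ((T a (columnType N c)).2 = 1 →
          (R (T a (columnType N c)).1 c' : ZMod (2 * m)) = R a c + 1) ∧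
        ((T a (columnType N c')).2 = -1 →
          (R (T a (columnType N c')).1 c : ZMod (2 * m)) = R a c' + 1) := by
    rintro c c' (⟨rfl, hc⟩ | ⟨rfl, hc⟩)
    · rcases Nat.lt_or_ge c N with hcN | hcN
      · refine hlink c (c + 1) c (c + 1) _ _ _ 0 (hspecial c hcN) (hw 0) ?_ ?_ ?_ ?_
        · simp [columnType, hcN]
        · unfold columnType; split_ifs <;> omega
        · intro p; rw [affineEval_atFirst]; congr 1; omega
        · intro p; rw [affineEval_atFirst]; congr 1; omega
      · rcases Nat.even_or_odd' (c - N) with ⟨q, hq | hq⟩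
        · refine hlink c (c + 1) N (N + 1) _ _ _ q hblock (hw q) ?_ ?_ ?_ ?_
          · unfold columnType; split_ifs <;> omega
          · unfold columnType; split_ifs <;> omega
          · intro p; rw [id]; congr 1; omega
          · intro p; rw [id]; congr 1; omega
        · refine hlink c (c + 1) (N + 1) N _ _ _ q hnext (hw q) ?_ ?_ ?_ ?_
          · unfold columnType; split_ifs <;> omega
          · unfold columnType; split_ifs <;> omega
          · intro p; rw [id]; congr 1; omega
          · intro p; rw [affineEval_atNext]; congr 1; omega
    · rcases Nat.eq_zero_or_pos k with hk | hk
      · subst hk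
        refine hlink c 0 (N - 1) 0 _ _ _ 0 hempty ?_ ?_ ?_ ?_ ?_
        · simp [affineEval, hm]
        · unfold columnType; split_ifs <;> omega
        · unfold columnType; split_ifs <;> omega
        · intro p; rw [Nat.cast_zero, affineEval_atEmpty]; congr 1; omega
        · intro p; rw [Nat.cast_zero, affineEval_atEmpty]; congr 1; omega
      · refine hlink c 0 (N + 1) 0 _ _ _ 0 hlast (hw 0) ?_ ?_ ?_ ?_
        · unfold columnType; split_ifs <;> omega
        · unfold columnType; split_ifs <;> omega
        · intro p; rw [affineEval_atLast]; congr 1; omega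
        · intro p; rw [affineEval_atFirst]; congr 1; omega
  obtain ⟨σ, hσ, hper⟩ := exists_perm_minimalPeriod_of_rank (n := 2 * m) (by simp [ZMod.card])
    (tableStep N m T) (fun v => (R v.1 v.2.val : ZMod (2 * m))) (by
      rintro ⟨a, c⟩
      have htype : columnType N c.val < N + 2 := by
        unfold columnType; split_ifs <;> omega
      rcases h₀ a _ htype with ⟨he, hr⟩ | he | he
      · have := hr.affineEval_cast (hw ((c.val - N) / 2 : ℕ))
        simpa [tableStep, he, R] using this
      · have := (hadj _ _ (ZMod.val_add_one_cases (by omega) c) a).1 he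
        simpa [tableStep, he] using this
      · obtain ⟨d, rfl⟩ : ∃ d, c = d + 1 := ⟨c - 1, by ring⟩
        have := (hadj _ _ (ZMod.val_add_one_cases (by omega) d) a).2 he
        simpa [tableStep, he] using this)
  exact ⟨σ, hσ, hper⟩

/-- The five entries of every column type exhaust all five arcs out of each vertex. -/
def CoversTable (N : ℕ) (T : Fin 5 → Fin 2 → ℕ → Fin 2 × ℤ) : Prop :=
  ∀ x < N + 2, ∀ a b, (∃ i, T i a x = (b, 1)) ∧ (∃ i, T i a x = (b, -1)) ∧
    (a ≠ b → ∃ i, T i a x = (b, 0))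

instance (N : ℕ) (T : Fin 5 → Fin 2 → ℕ → Fin 2 × ℤ) : Decidable (CoversTable N T) :=
  inferInstanceAs (Decidable (∀ x < N + 2, _))

theorem isFactorization_of_tables {N k m : ℕ} (hN : 3 ≤ N) (hm : m = N + 2 * k)
    {T : Fin 5 → Fin 2 → ℕ → Fin 2 × ℤ} {ρ : Fin 5 → Fin 2 → ℕ → ℤ × ℤ × ℤ}
    (hT : ∀ i, IsHamiltonianTable N (T i) (ρ i)) (hcover : CoversTable N T) :
    IsFactorization (cycleStarBlowup m ∪ IStar m) (fun _ : Fin 5 => 2 * m) := by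
  choose σ hσ hper using fun i => (hT i).exists_perm (by omega) hm
  refine isFactorization_of_cover (by omega) _ σ hper ?_
  rintro ⟨a, c⟩ ⟨b, d⟩ h
  have htype : columnType N c.val < N + 2 := by
    unfold columnType; split_ifs <;> omega
  obtain ⟨h₁, h₂, h₃⟩ := hcover _ htype a b
  simp only [cycleStarBlowup, IStar, Set.mem_union, Set.mem_ofPred_eq] at h
  rcases h with (rfl | rfl) | ⟨rfl, hab⟩
  · obtain ⟨i, hi⟩ := h₁
    exact ⟨i, by simp [hσ, tableStep, hi]⟩
  · obtain ⟨i, hi⟩ := h₂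
    exact ⟨i, by simp [hσ, tableStep, hi]⟩
  · obtain ⟨i, hi⟩ := h₃ hab
    exact ⟨i, by simp [hσ, tableStep, hi]⟩

/-- Successor tables of five directed Hamiltonian cycles for an odd number of columns. -/
def oddArcs : Fin 5 → Fin 2 → List (Fin 2 × ℤ) :=
  ![![[(0, 1), (1, 0), (1, 0), (1, 0), (1, 0), (0, 1), (1, 0)],
      [(0, 0), (0, 1), (0, 1), (0, 1), (1, 1), (0, 0), (1, 1)]],
    ![[(1, 0), (0, 1), (1, 1), (1, -1), (0, -1), (1, 1), (1, -1)],
      [(0, -1), (0, 0), (1, -1), (1, 1), (0, 1), (0, -1), (0, 1)]],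
    ![[(1, 1), (1, 1), (0, 1), (1, 1), (0, 1), (1, 0), (0, 1)],
      [(0, 1), (1, -1), (1, 1), (0, -1), (0, 0), (1, 1), (0, 0)]],
    ![[(0, -1), (0, -1), (1, -1), (0, -1), (1, 1), (0, -1), (1, 1)],
      [(1, -1), (1, 1), (0, -1), (0, 0), (1, -1), (1, -1), (0, -1)]],
    ![[(1, -1), (1, -1), (0, -1), (0, 1), (1, -1), (1, -1), (0, -1)],
      [(1, 1), (0, -1), (0, 0), (1, -1), (0, -1), (0, 1), (1, -1)]]]

/-- The positions of the vertices along the cycles described by `oddArcs`. -/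
def oddRanks : Fin 5 → Fin 2 → List (ℤ × ℤ × ℤ) :=
  ![![[(0, 0, 0), (1, 0, 0), (3, 0, 0), (5, 0, 0), (7, 0, 0), (10, 4, 0), (11, 4, 0)],
      [(9, 0, 4), (2, 0, 0), (4, 0, 0), (6, 0, 0), (8, 0, 0), (9, 4, 0), (12, 4, 0)]],
    ![[(0, 0, 0), (6, 0, 2), (7, 0, 2), (3, 0, 2), (2, 0, 2), (10, 2, 2), (0, -2, 2)],
      [(1, 0, 0), (5, 0, 2), (4, 0, 2), (8, 0, 2), (9, 0, 2), (1, -2, 2), (11, 2, 2)]],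
    ![[(0, 0, 0), (3, 0, 0), (6, 0, 0), (7, 0, 0), (9, 0, 0), (10, 4, 0), (13, 4, 0)],
      [(2, 0, 0), (1, 0, 0), (4, 0, 0), (5, 0, 0), (8, 0, 0), (11, 4, 0), (12, 4, 0)]],
    ![[(0, 0, 0), (9, 0, 4), (6, 0, 4), (5, 0, 4), (1, 0, 4), (0, -4, 4), (-3, -4, 4)],
      [(2, 0, 0), (7, 0, 4), (8, 0, 4), (4, 0, 4), (3, 0, 4), (2, -4, 4), (-1, -4, 4)]],
    ![[(0, 0, 0), (7, 0, 4), (6, 0, 4), (2, 0, 4), (3, 0, 4), (0, -4, 4), (-1, -4, 4)],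
      [(8, 0, 4), (9, 0, 4), (5, 0, 4), (4, 0, 4), (1, 0, 4), (-2, -4, 4), (-3, -4, 4)]]]

/-- Successor tables of five directed Hamiltonian cycles for an even number of columns. -/
def evenArcs : Fin 5 → Fin 2 → List (Fin 2 × ℤ) :=
  ![![[(0, -1), (1, 0), (0, -1), (1, -1), (0, -1), (1, 0), (0, -1), (1, 0)],
      [(0, 0), (1, -1), (0, 0), (0, 1), (1, -1), (1, -1), (0, 0), (1, -1)]],
    ![[(1, 0), (0, -1), (1, 0), (0, -1), (1, -1), (1, -1), (0, 1), (1, -1)],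
      [(1, -1), (0, 0), (1, -1), (0, 0), (0, 0), (0, 0), (1, -1), (0, -1)]],
    ![[(1, -1), (0, 1), (1, -1), (1, 0), (1, 0), (0, -1), (1, -1), (0, -1)],
      [(0, -1), (0, -1), (0, -1), (1, -1), (0, -1), (1, 1), (0, -1), (1, 1)]],
    ![[(1, 1), (1, 1), (1, 1), (0, 1), (1, 1), (1, 1), (1, 1), (1, 1)],
      [(0, 1), (0, 1), (0, 1), (1, 1), (0, 1), (0, 1), (0, 1), (0, 1)]],
    ![[(0, 1), (1, -1), (0, 1), (1, 1), (0, 1), (0, 1), (1, 0), (0, 1)],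
      [(1, 1), (1, 1), (1, 1), (0, -1), (1, 1), (0, -1), (1, 1), (0, 0)]]]

/-- The positions of the vertices along the cycles described by `evenArcs`. -/
def evenRanks : Fin 5 → Fin 2 → List (ℤ × ℤ × ℤ) :=
  ![![[(0, 0, 0), (9, 0, 4), (8, 0, 4), (6, 0, 4), (5, 0, 4), (1, 0, 4), (0, -4, 4), (-3, -4, 4)],
      [(11, 0, 4), (10, 0, 4), (7, 0, 4), (4, 0, 4), (3, 0, 4), (2, 0, 4), (-1, -4, 4), (-2, -4, 4)]],
    ![[(0, 0, 0), (11, 0, 4), (8, 0, 4), (7, 0, 4), (5, 0, 4), (3, 0, 4), (-1, -4, 4), (0, -4, 4)],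
      [(1, 0, 0), (10, 0, 4), (9, 0, 4), (6, 0, 4), (4, 0, 4), (2, 0, 4), (1, -4, 4), (-2, -4, 4)]],
    ![[(0, 0, 0), (9, 0, 4), (10, 0, 4), (6, 0, 4), (4, 0, 4), (3, 0, 4), (0, -4, 4), (-1, -4, 4)],
      [(2, 0, 0), (11, 0, 4), (8, 0, 4), (7, 0, 4), (5, 0, 4), (1, 0, 4), (2, -4, 4), (-3, -4, 4)]],
    ![[(0, 0, 0), (7, 0, 2), (2, 0, 0), (9, 0, 2), (10, 0, 2), (5, 0, 0), (12, 2, 2), (7, 2, 0)],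
      [(6, 0, 2), (1, 0, 0), (8, 0, 2), (3, 0, 0), (4, 0, 0), (11, 0, 2), (6, 2, 0), (13, 2, 2)]],
    ![[(0, 0, 0), (1, 0, 0), (6, 0, 0), (7, 0, 0), (10, 0, 0), (11, 0, 0), (12, 4, 0), (15, 4, 0)],
      [(2, 0, 0), (3, 0, 0), (4, 0, 0), (5, 0, 0), (8, 0, 0), (9, 0, 0), (13, 4, 0), (14, 4, 0)]]]

theorem isFactorization_hamiltonian {m : ℕ} (hm : 5 ≤ m) :
    IsFactorization (cycleStarBlowup m ∪ IStar m) (fun _ : Fin 5 => 2 * m) := by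
  rcases Nat.even_or_odd' m with ⟨k, hk | hk⟩
  · exact isFactorization_of_tables (N := 6) (k := k - 3) (by norm_num) (by omega)
      (T := fun i a x => (evenArcs i a).getD x (0, 0))
      (ρ := fun i a x => (evenRanks i a).getD x (0, 0, 0)) (by decide) (by decide)
  · exact isFactorization_of_tables (N := 5) (k := k - 2) (by norm_num) (by omega)
      (T := fun i a x => (oddArcs i a).getD x (0, 0))
      (ρ := fun i a x => (oddRanks i a).getD x (0, 0, 0)) (by decide) (by decide)

theorem exists_swap_rows (m : ℕ) :
    ∃ ι : Equiv.Perm (Fin 2 × ZMod m), (∀ v, Function.minimalPeriod ι v = 2) ∧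
      ∀ u v, (u, v) ∈ IStar m → ι u = v := by
  have h1 : ∀ x : Fin 2, x + 1 + 1 = x := by decide
  have h2 : ∀ x : Fin 2, x + 1 ≠ x := by decide
  have h3 : ∀ x y : Fin 2, x ≠ y → x + 1 = y := by decide
  have hι : Function.Involutive fun v : Fin 2 × ZMod m => (v.1 + 1, v.2) := by
    rintro ⟨a, c⟩; simp [h1]
  refine ⟨hι.toPerm, minimalPeriod_eq_two_s9 hι (by rintro ⟨a, c⟩; simp [h2]), ?_⟩
  rintro ⟨a, c⟩ ⟨b, d⟩ h
  simp only [IStar, Set.mem_ofPred_eq] at h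
  obtain ⟨rfl, hab⟩ := h
  simp [h3 a b hab]

/-- For `m ≥ 5`, the digraph `C_m*[2] ⊕ I*_{2m}` has a factorization into `r`
`K_2*`-factors and `s` `C⃗_{2m}`-factors for every `r ∈ {0, 1, 3, 5}` with
`r + s = 5`. -/
theorem cycleStarBlowup_IStar_K2_C2m (m r s : ℕ) (hm : 5 ≤ m)
    (hr : r = 0 ∨ r = 1 ∨ r = 3 ∨ r = 5) (hrs : r + s = 5) :
    IsFactorization (cycleStarBlowup m ∪ IStar m)
      (fun i : Fin (r + s) => if (i : ℕ) < r then 2 else 2 * m) := by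
  rcases hr with rfl | rfl | rfl | rfl
  · obtain rfl : s = 5 := by omega
    exact isFactorization_hamiltonian hm
  all_goals
    obtain ⟨ι, hι, hcι⟩ := exists_swap_rows m
    obtain ⟨σ, τ, ρ, ρ', ⟨hσ, hσ'⟩, ⟨hτ, hτ'⟩, hcov⟩ :=
      exists_hamiltonian_pair (m := m) (by omega)
    obtain ⟨μ, ν, hμ, hν, hμν⟩ := exists_matchings σ ρ hσ
    obtain ⟨μ', ν', hμ', hν', hμν'⟩ := exists_matchings τ ρ' hτ
  · obtain rfl : s = 4 := by omega
    refine isFactorization_of_cover (by omega) _ ![ι, σ, σ.symm, τ, τ.symm] ?_ ?_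
    · intro i x
      fin_cases i <;> simp [hι, hσ', hτ', minimalPeriod_symm]
    · rintro u v (h | h)
      · simpa [Fin.exists_fin_succ] using Or.inr (hcov u v h)
      · exact ⟨0, hcι u v h⟩
  · obtain rfl : s = 2 := by omega
    refine isFactorization_of_cover (by omega) _ ![ι, μ, ν, τ, τ.symm] ?_ ?_
    · intro i x
      fin_cases i <;> simp [hι, hμ, hν, hτ', minimalPeriod_symm]
    · rintro u v (h | h)
      · have := hcov u v h
        have := hμν u
        simp only [Fin.exists_fin_succ, Matrix.cons_val_zero, Matrix.cons_val_succ]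
        grind
      · exact ⟨0, hcι u v h⟩
  · obtain rfl : s = 0 := by omega
    refine isFactorization_of_cover (by omega) _ ![ι, μ, ν, μ', ν'] ?_ ?_
    · intro i x
      fin_cases i <;> simp [hι, hμ, hν, hμ', hν']
    · rintro u v (h | h)
      · have := hcov u v h
        have := hμν u
        have := hμν' u
        simp only [Fin.exists_fin_succ, Matrix.cons_val_zero, Matrix.cons_val_succ]
        grind
      · exact ⟨0, hcι u v h⟩
end

section
/- Let m ≥ 4 be an even integer. Then the digraph C_m*[2] has a factorization into r K_2*-factors and s C⃗_m-factors for every r ∈ {0, 2, 4} with r + s = 4. -/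
/-- Translation by `a` on an additive group has all periods equal to the additive order of `a`. -/
theorem minimalPeriod_addRight {G : Type*} [AddGroup G] (a x : G) :
    Function.minimalPeriod (Equiv.addRight a) x = addOrderOf a := by
  have key (n : ℕ) : (⇑(Equiv.addRight a))^[n] x = x ↔ n • a = 0 := by
    rw [Equiv.coe_addRight, add_right_iterate, add_eq_left]
  apply Nat.dvd_antisymm
  · exact Function.IsPeriodicPt.minimalPeriod_dvd ((key _).2 (addOrderOf_nsmul_eq_zero a))
  · exact addOrderOf_dvd_of_nsmul_eq_zero
      ((key _).1 (Function.isPeriodicPt_minimalPeriod _ x))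

theorem minimalPeriod_eq_two_of_involutive {α : Type*} {f : α → α}
    (hf : Function.Involutive f) {x : α} (hx : f x ≠ x) : Function.minimalPeriod f x = 2 :=
  Function.minimalPeriod_eq_prime (hf x) hx

theorem addOrderOf_mk_fin_two {m : ℕ} (hme : Even m) (a : Fin 2) {d : ZMod m}
    (hd : addOrderOf d = m) : addOrderOf (a, d) = m := by
  rw [Prod.addOrderOf_mk, hd]
  have h : addOrderOf a ∣ 2 := by simpa using addOrderOf_dvd_card (x := a)
  exact Nat.lcm_eq_right (h.trans hme.two_dvd)

/-- The matching of `C_m[2]` shifting the first coordinate by `a` and pairing `u` with `u + 1`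
in the second coordinate whenever `u` has parity `b`. -/
def pairing {m : ℕ} (h2 : 2 ∣ m) (a : Fin 2) (b : ZMod 2) (x : Fin 2 × ZMod m) :
    Fin 2 × ZMod m :=
  (x.1 + a, if ZMod.castHom h2 (ZMod 2) x.2 = b then x.2 + 1 else x.2 - 1)

theorem pairing_involutive {m : ℕ} (h2 : 2 ∣ m) (a : Fin 2) (b : ZMod 2) :
    Function.Involutive (pairing h2 a b) := by
  rintro ⟨i, u⟩
  have hi : i + a + a = i := by revert i a; decide
  have hp : ∀ p : ZMod 2, (p = b → p + 1 ≠ b) ∧ (p ≠ b → p - 1 = b) := by revert b; decide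
  obtain ⟨h1, h3⟩ := hp (ZMod.castHom h2 (ZMod 2) u)
  by_cases h : ZMod.castHom h2 (ZMod 2) u = b
  · have := h1 h
    simp only [pairing, hi, if_pos h, map_add, map_one, if_neg this, add_sub_cancel_right]
  · have := h3 h
    simp only [pairing, hi, if_neg h, map_sub, map_one, if_pos this, sub_add_cancel]

theorem minimalPeriod_pairing {m : ℕ} (h2 : 2 ∣ m) (hm : 4 ≤ m) (a : Fin 2) (b : ZMod 2)
    (x : Fin 2 × ZMod m) :
    Function.minimalPeriod (pairing_involutive h2 a b).toPerm x = 2 := by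
  have : Fact (1 < m) := ⟨by omega⟩
  refine minimalPeriod_eq_two_of_involutive (pairing_involutive h2 a b) fun h => ?_
  have h := congrArg Prod.snd h
  simp only [pairing] at h
  split_ifs at h <;> simp at h

theorem add_one_ne_sub_one_zmod {m : ℕ} (hm : 4 ≤ m) (u : ZMod m) : u + 1 ≠ u - 1 := by
  intro h
  have h' : ((2 : ℕ) : ZMod m) = 0 := by push_cast; linear_combination h
  have := Nat.le_of_dvd two_pos ((ZMod.natCast_eq_zero_iff 2 m).1 h')
  omega

/-- Four permutations that at every vertex take, in some order, the four neighbours in `C_m*[2]`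
as values, and whose periods are prescribed by `c`, form a factorization of `C_m*[2]`. -/
theorem isFactorization_cycleStarBlowup {m : ℕ} (hm : 4 ≤ m) (c : Fin 4 → ℕ)
    (f : Fin 4 → Equiv.Perm (Fin 2 × ZMod m))
    (hc : ∀ i x, Function.minimalPeriod (f i) x = c i)
    (hf : ∀ i u, ∃ e : Fin 4 → Fin 4, e.Surjective ∧ ∀ k, f (e k) (i, u) =
      ![(i, u + 1), (i, u - 1), (i + 1, u + 1), (i + 1, u - 1)] k) :
    IsFactorization (cycleStarBlowup m) c := by
  have hfin (i : Fin 2) : i ≠ i + 1 ∧ i + 1 ≠ i := by revert i; decide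
  have hcov (i j : Fin 2) : j = i ∨ j = i + 1 := by revert i j; decide
  refine ⟨f, hc, ?_, ?_⟩
  · rintro k l ⟨i, u⟩ h
    obtain ⟨e, hs, he⟩ := hf i u
    obtain ⟨k, rfl⟩ := hs k
    obtain ⟨l, rfl⟩ := hs l
    rw [he, he] at h
    have hne := add_one_ne_sub_one_zmod hm u
    congr 1
    fin_cases k <;> fin_cases l <;>
      first
        | rfl
        | exact absurd (congrArg Prod.fst h) (hfin i).1
        | exact absurd (congrArg Prod.fst h) (hfin i).2
        | exact absurd (congrArg Prod.snd h) hne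
        | exact absurd (congrArg Prod.snd h) hne.symm
  · rintro ⟨⟨i, u⟩, ⟨j, v⟩⟩
    have harc : u = v + 1 ↔ v = u - 1 := by rw [eq_sub_iff_add_eq, eq_comm]
    obtain ⟨e, hs, he⟩ := hf i u
    rw [hs.exists]
    simp only [he, Fin.exists_fin_succ, cycleStarBlowup, Set.mem_ofPred_eq, harc]
    rcases hcov i j with rfl | rfl <;> simp [hfin, eq_comm]

/-- For even `m ≥ 4`, the digraph `C_m*[2]` has a factorization into `r` `K_2*`-factors
and `s` `C⃗_m`-factors for every `r ∈ {0, 2, 4}` with `r + s = 4`. -/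
theorem cycleStarBlowup_K2_Cm (m r s : ℕ) (hm : 4 ≤ m) (hme : Even m)
    (hr : r = 0 ∨ r = 2 ∨ r = 4) (hrs : r + s = 4) :
    IsFactorization (cycleStarBlowup m)
      (fun i : Fin (r + s) => if (i : ℕ) < r then 2 else m) := by
  have h2 : 2 ∣ m := hme.two_dvd
  have hone : addOrderOf (1 : ZMod m) = m := ZMod.addOrderOf_one m
  have hneg : addOrderOf (-1 : ZMod m) = m := by rw [addOrderOf_neg, hone]
  have hT (a : Fin 2) (d : ZMod m) (hd : addOrderOf d = m) (x : Fin 2 × ZMod m) :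
      Function.minimalPeriod (Equiv.addRight (a, d)) x = m := by
    rw [minimalPeriod_addRight, addOrderOf_mk_fin_two hme a hd]
  have hP := minimalPeriod_pairing h2 hm
  let T (a : Fin 2) (d : ZMod m) : Equiv.Perm (Fin 2 × ZMod m) := Equiv.addRight (a, d)
  let P (a : Fin 2) (b : ZMod 2) : Equiv.Perm (Fin 2 × ZMod m) :=
    (pairing_involutive h2 a b).toPerm
  have hTx (a d i u) : T a d (i, u) = (i + a, u + d) := rfl
  have hPx (a b i u) : P a b (i, u) =
      (i + a, if ZMod.castHom h2 (ZMod 2) u = b then u + 1 else u - 1) := rfl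
  have hpar (p : ZMod 2) : p = 0 ∧ p ≠ 1 ∨ p ≠ 0 ∧ p = 1 := by revert p; decide
  rcases hr with rfl | rfl | rfl
  · obtain rfl : s = 4 := by omega
    refine isFactorization_cycleStarBlowup hm _ ![T 0 1, T 0 (-1), T 1 1, T 1 (-1)] ?_
      fun i u => ⟨id, Function.surjective_id, ?_⟩
    · intro k x
      fin_cases k
      exacts [hT 0 1 hone x, hT 0 (-1) hneg x, hT 1 1 hone x, hT 1 (-1) hneg x]
    · intro k
      fin_cases k <;> simp [hTx, sub_eq_add_neg]
  · obtain rfl : s = 2 := by omega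
    refine isFactorization_cycleStarBlowup hm _ ![P 0 0, P 0 1, T 1 1, T 1 (-1)] ?_ fun i u => ?_
    · intro k x
      fin_cases k
      exacts [hP 0 0 x, hP 0 1 x, hT 1 1 hone x, hT 1 (-1) hneg x]
    · rcases hpar (ZMod.castHom h2 (ZMod 2) u) with h | h
      · refine ⟨id, Function.surjective_id, fun k => ?_⟩
        fin_cases k <;> simp [hTx, hPx, h, sub_eq_add_neg]
      · refine ⟨![1, 0, 2, 3], by decide, fun k => ?_⟩
        fin_cases k <;> simp [hTx, hPx, h, sub_eq_add_neg]
  · obtain rfl : s = 0 := by omega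
    refine isFactorization_cycleStarBlowup hm _ ![P 0 0, P 0 1, P 1 0, P 1 1] ?_ fun i u => ?_
    · intro k x
      fin_cases k
      exacts [hP 0 0 x, hP 0 1 x, hP 1 0 x, hP 1 1 x]
    · rcases hpar (ZMod.castHom h2 (ZMod 2) u) with h | h
      · refine ⟨id, Function.surjective_id, fun k => ?_⟩
        fin_cases k <;> simp [hPx, h]
      · refine ⟨![1, 0, 3, 2], by decide, fun k => ?_⟩
        fin_cases k <;> simp [hPx, h]
end

section
/- Let m ≡ 2 (mod 4) with m ≥ 6. Then the digraph Γ*_m = C*[2] ⊕ F_m*[2] has a factorization into r K_2*-factors and s C⃗_m-factors for every r ∈ {1, 2, 3, 4, 6} with r + s = 6. -/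
/-- If `L` labels the points of `V` by residues modulo `m` so that `f` increments labels, and
points with equal label are separated by an `f`-invariant predicate, then all periods are `m`. -/
lemma minimalPeriod_eq_of_label_s13 {V : Type*} {m : ℕ} (f : V → V) (L : V → ℕ) (κ : V → Prop)
    (hL : ∀ v, L (f v) = L v + 1 ∨ L v + 1 = m ∧ L (f v) = 0)
    (hκ : ∀ v, κ (f v) ↔ κ v) (hlt : ∀ v, L v < m)
    (hinj : ∀ v w, L v = L w → (κ v ↔ κ w) → v = w) (v : V) :
    Function.minimalPeriod f v = m := by
  have hiter : ∀ n : ℕ, (L (f^[n] v) : ZMod m) = L v + n ∧ (κ (f^[n] v) ↔ κ v) := by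
    intro n
    induction n with
    | zero => simp
    | succ n ih =>
      rw [Function.iterate_succ_apply', hκ]
      refine ⟨?_, ih.2⟩
      rw [Nat.cast_succ, ← add_assoc, ← ih.1]
      rcases hL (f^[n] v) with h | ⟨h, h'⟩
      · rw [h, Nat.cast_succ]
      · rw [h', ← Nat.cast_succ, Nat.succ_eq_add_one, h]
        simp
  apply Nat.dvd_antisymm
  · apply Function.IsPeriodicPt.minimalPeriod_dvd
    refine hinj _ _ ?_ (hiter m).2
    have h := (hiter m).1
    rw [ZMod.natCast_self, add_zero, ZMod.natCast_eq_natCast_iff] at h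
    exact Nat.ModEq.eq_of_lt_of_lt h (hlt _) (hlt _)
  · have h := (hiter (Function.minimalPeriod f v)).1
    rw [Function.iterate_minimalPeriod] at h
    rw [← ZMod.natCast_eq_zero_iff]
    simpa using h

/-- The permutation `(x, i) ↦ (x, σ i)`. -/
def keepSheet {W : Type} (σ : Equiv.Perm W) : Equiv.Perm (Fin 2 × W) :=
  Equiv.prodShear (Equiv.refl _) fun _ => σ

/-- The permutation `(0, i) ↦ (1, σ i)`, `(1, i) ↦ (0, τ i)`. -/
def swapSheet {W : Type} (σ τ : Equiv.Perm W) : Equiv.Perm (Fin 2 × W) :=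
  Equiv.prodShear (Equiv.swap 0 1) ![σ, τ]

@[simp] lemma keepSheet_apply {W : Type} (σ : Equiv.Perm W) (x : Fin 2) (i : W) :
    keepSheet σ (x, i) = (x, σ i) := rfl

@[simp] lemma swapSheet_zero {W : Type} (σ τ : Equiv.Perm W) (i : W) :
    swapSheet σ τ (0, i) = (1, σ i) := rfl

@[simp] lemma swapSheet_one {W : Type} (σ τ : Equiv.Perm W) (i : W) :
    swapSheet σ τ (1, i) = (0, τ i) := rfl

lemma minimalPeriod_keepSheet {W : Type} (σ : Equiv.Perm W) (hσ : ∀ i, σ (σ i) = i)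
    (hne : ∀ i, σ i ≠ i) (v : Fin 2 × W) : Function.minimalPeriod (keepSheet σ) v = 2 := by
  obtain ⟨x, i⟩ := v
  apply Function.minimalPeriod_eq_prime
  · simp [Function.IsPeriodicPt, Function.IsFixedPt, hσ]
  · simp [Function.IsFixedPt, hne]

lemma minimalPeriod_swapSheet {W : Type} (σ : Equiv.Perm W) (hσ : ∀ i, σ (σ i) = i)
    (v : Fin 2 × W) : Function.minimalPeriod (swapSheet σ σ) v = 2 := by
  obtain ⟨x, i⟩ := v
  apply Function.minimalPeriod_eq_prime <;> fin_cases x <;>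
    simp [Function.IsPeriodicPt, Function.IsFixedPt, hσ]

namespace ZMod

variable {m : ℕ} [NeZero m]

lemma val_add_one_eq_ite (hm : 2 ≤ m) (i : ZMod m) :
    (i + 1).val = if i.val + 1 = m then 0 else i.val + 1 := by
  have hi := i.val_lt
  have h1 : (1 : ZMod m).val = 1 := val_one'' (by omega)
  rw [val_add, h1]
  split_ifs with h
  · rw [h, Nat.mod_self]
  · exact Nat.mod_eq_of_lt (by omega)

lemma val_sub_one_eq_ite (hm : 2 ≤ m) (i : ZMod m) :
    (i - 1).val = if i.val = 0 then m - 1 else i.val - 1 := by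
  have h := val_add_one_eq_ite hm (i - 1)
  have hi := (i - 1).val_lt
  rw [sub_add_cancel] at h
  split_ifs at h ⊢ <;> omega

lemma val_neg_eq_ite (i : ZMod m) : (-i).val = if i.val = 0 then 0 else m - i.val := by
  rw [neg_val]
  simp [val_eq_zero]

end ZMod

section Matchings

variable (m : ℕ)

/-- The involution of the perfect matching `{2j, 2j + 1}` of the cycle. -/
def evenMatch (i : ZMod m) : ZMod m := if i.val % 2 = 0 then i + 1 else i - 1

/-- The involution of the perfect matching `{2j - 1, 2j}` of the cycle. -/
def oddMatch (i : ZMod m) : ZMod m := if i.val % 2 = 0 then i - 1 else i + 1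

/-- The involution of the `1`-factor `F_m`. -/
def rungMatch (i : ZMod m) : ZMod m :=
  if i = 0 then ((m / 2 : ℕ) : ZMod m) else if i = ((m / 2 : ℕ) : ZMod m) then 0 else -i

variable {m} [NeZero m]

lemma val_evenMatch (hm : 6 ≤ m) (hmod : m % 4 = 2) (i : ZMod m) :
    (evenMatch m i).val = if i.val % 2 = 0 then i.val + 1 else i.val - 1 := by
  have hi := i.val_lt
  unfold evenMatch
  split_ifs
  · rw [ZMod.val_add_one_eq_ite (by omega), if_neg (by omega)]
  · rw [ZMod.val_sub_one_eq_ite (by omega), if_neg (by omega)]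

lemma val_oddMatch (hm : 6 ≤ m) (hmod : m % 4 = 2) (i : ZMod m) :
    (oddMatch m i).val = if i.val = 0 then m - 1 else if i.val + 1 = m then 0 else
      if i.val % 2 = 0 then i.val - 1 else i.val + 1 := by
  have hi := i.val_lt
  unfold oddMatch
  split_ifs <;> simp only [ZMod.val_add_one_eq_ite (show 2 ≤ m by omega),
    ZMod.val_sub_one_eq_ite (show 2 ≤ m by omega)] <;> split_ifs <;> omega

omit [NeZero m] in
lemma val_half (hm : 6 ≤ m) : ((m / 2 : ℕ) : ZMod m).val = m / 2 :=
  ZMod.val_cast_of_lt (by omega)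

lemma val_rungMatch (hm : 6 ≤ m) (i : ZMod m) :
    (rungMatch m i).val = if i.val = 0 then m / 2 else if i.val = m / 2 then 0 else
      m - i.val := by
  have h0 : i = 0 ↔ i.val = 0 := (ZMod.val_eq_zero i).symm
  have h1 : i = ((m / 2 : ℕ) : ZMod m) ↔ i.val = m / 2 := by
    rw [← (ZMod.val_injective m).eq_iff, val_half hm]
  unfold rungMatch
  simp only [h0, h1]
  split_ifs with h h'
  · exact val_half hm
  · exact ZMod.val_zero
  · rw [ZMod.val_neg_eq_ite, if_neg h]

lemma evenMatch_involutive (hm : 6 ≤ m) (hmod : m % 4 = 2) :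
    Function.Involutive (evenMatch m) := fun i => ZMod.val_injective m <| by
  have hi := i.val_lt
  have h := val_evenMatch hm hmod i
  rw [val_evenMatch hm hmod]
  split_ifs at h ⊢ <;> omega

lemma oddMatch_involutive (hm : 6 ≤ m) (hmod : m % 4 = 2) :
    Function.Involutive (oddMatch m) := fun i => ZMod.val_injective m <| by
  have hi := i.val_lt
  have h := val_oddMatch hm hmod i
  rw [val_oddMatch hm hmod]
  split_ifs at h ⊢ <;> omega

lemma rungMatch_involutive (hm : 6 ≤ m) (hmod : m % 4 = 2) :
    Function.Involutive (rungMatch m) := fun i => ZMod.val_injective m <| by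
  have hi := i.val_lt
  have h := val_rungMatch hm i
  rw [val_rungMatch hm]
  split_ifs at h ⊢ <;> omega

lemma evenMatch_ne_self (hm : 6 ≤ m) (hmod : m % 4 = 2) (i : ZMod m) :
    evenMatch m i ≠ i := fun h => by
  have hi := i.val_lt
  have h' := congrArg ZMod.val h
  rw [val_evenMatch hm hmod] at h'
  split_ifs at h' <;> omega

lemma oddMatch_ne_self (hm : 6 ≤ m) (hmod : m % 4 = 2) (i : ZMod m) :
    oddMatch m i ≠ i := fun h => by
  have hi := i.val_lt
  have h' := congrArg ZMod.val h
  rw [val_oddMatch hm hmod] at h'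
  split_ifs at h' <;> omega

lemma rungMatch_ne_self (hm : 6 ≤ m) (hmod : m % 4 = 2) (i : ZMod m) :
    rungMatch m i ≠ i := fun h => by
  have hi := i.val_lt
  have h' := congrArg ZMod.val h
  rw [val_rungMatch hm] at h'
  split_ifs at h' <;> omega

lemma rungMatch_ne_add_one (hm : 6 ≤ m) (hmod : m % 4 = 2) (i : ZMod m) :
    rungMatch m i ≠ i + 1 := fun h => by
  have hi := i.val_lt
  have h' := congrArg ZMod.val h
  rw [val_rungMatch hm, ZMod.val_add_one_eq_ite (by omega)] at h'
  split_ifs at h' <;> omega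

lemma rungMatch_ne_sub_one (hm : 6 ≤ m) (hmod : m % 4 = 2) (i : ZMod m) :
    rungMatch m i ≠ i - 1 := fun h => by
  have hi := i.val_lt
  have h' := congrArg ZMod.val h
  rw [val_rungMatch hm, ZMod.val_sub_one_eq_ite (by omega)] at h'
  split_ifs at h' <;> omega

lemma add_one_ne_sub_one (hm : 6 ≤ m) (i : ZMod m) : i + 1 ≠ i - 1 := fun h => by
  have hi := i.val_lt
  have h' := congrArg ZMod.val h
  rw [ZMod.val_add_one_eq_ite (by omega), ZMod.val_sub_one_eq_ite (by omega)] at h'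
  split_ifs at h' <;> omega

omit [NeZero m] in
lemma mem_GammaStar_iff (hm : 6 ≤ m) (x y : Fin 2) (i j : ZMod m) :
    ((x, i), (y, j)) ∈ GammaStar m ↔ i + 1 = j ∨ i - 1 = j ∨ rungMatch m i = j := by
  have h0 : ((m / 2 : ℕ) : ZMod m) ≠ 0 := fun h => by
    have := val_half hm
    rw [h, ZMod.val_zero] at this
    omega
  have h1 : i = j + 1 ↔ i - 1 = j := sub_eq_iff_eq_add.symm
  unfold GammaStar cycleStarBlowup FStarBlowup rungMatch
  simp only [Set.mem_union, Set.mem_ofPred_eq, h1, eq_comm (a := j)]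
  split_ifs with hi hi'
  · subst hi
    simp [h0.symm, or_assoc]
  · subst hi'
    simp [h0, or_assoc]
  · simp [hi, hi', or_assoc]


/-- Equality of two vertices from the numerical values of their coordinates. -/
lemma prod_ext_val {v w : Fin 2 × ZMod m} (h₁ : v.1.val = w.1.val) (h₂ : v.2.val = w.2.val) :
    v = w :=
  Prod.ext (Fin.ext h₁) (ZMod.val_injective m h₂)

/-- `minimalPeriod_eq_of_label` with labels computed from the coordinates as natural numbers. -/
lemma minimalPeriod_eq_of_val_label (f : Fin 2 × ZMod m → Fin 2 × ZMod m) (L : ℕ → ℕ → ℕ)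
    (κ : ℕ → ℕ → Prop)
    (hstep : ∀ x i, ∀ x' n n', x' = (f (x, i)).1.val → n = i.val → n' = (f (x, i)).2.val →
      n < m → (L x' n' = L x.val n + 1 ∨ L x.val n + 1 = m ∧ L x' n' = 0) ∧
        (κ x' n' ↔ κ x.val n))
    (hlt : ∀ x n, x < 2 → n < m → L x n < m)
    (hinj : ∀ x n y k, x < 2 → n < m → y < 2 → k < m → L x n = L y k → (κ x n ↔ κ y k) →
      x = y ∧ n = k) (v : Fin 2 × ZMod m) : Function.minimalPeriod f v = m := by
  refine minimalPeriod_eq_of_label_s13 f (fun v => L v.1.val v.2.val) (fun v => κ v.1.val v.2.val)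
    (fun v => (hstep v.1 v.2 _ _ _ rfl rfl rfl v.2.val_lt).1)
    (fun v => (hstep v.1 v.2 _ _ _ rfl rfl rfl v.2.val_lt).2)
    (fun v => hlt _ _ v.1.is_lt v.2.val_lt) (fun v w h h' => ?_) v
  obtain ⟨h₁, h₂⟩ := hinj _ _ _ _ v.1.is_lt v.2.val_lt w.1.is_lt w.2.val_lt h h'
  exact prod_ext_val h₁ h₂

lemma minimalPeriod_keepSheet_addRight (hm : 6 ≤ m) (v : Fin 2 × ZMod m) :
    Function.minimalPeriod (keepSheet (Equiv.addRight 1)) v = m := by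
  refine minimalPeriod_eq_of_val_label _ (fun _ n => n) (fun x _ => x = 0) ?_ ?_ ?_ v
  · intro x i x' n n' hx hn hn' hlt
    simp only [keepSheet_apply, Equiv.coe_addRight,
      ZMod.val_add_one_eq_ite (show 2 ≤ m by omega)] at hx hn'
    grind
  · grind
  · grind

lemma minimalPeriod_keepSheet_subRight (hm : 6 ≤ m) (v : Fin 2 × ZMod m) :
    Function.minimalPeriod (keepSheet (Equiv.subRight 1)) v = m := by
  refine minimalPeriod_eq_of_val_label _ (fun _ n => m - 1 - n) (fun x _ => x = 0) ?_ ?_ ?_ v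
  · intro x i x' n n' hx hn hn' hlt
    simp only [keepSheet_apply, Equiv.subRight_apply,
      ZMod.val_sub_one_eq_ite (show 2 ≤ m by omega)] at hx hn'
    grind
  · grind
  · grind

lemma minimalPeriod_swapSheet_addRight (hm : 6 ≤ m) (hmod : m % 4 = 2) (v : Fin 2 × ZMod m) :
    Function.minimalPeriod (swapSheet (Equiv.addRight 1) (Equiv.addRight 1)) v = m := by
  refine minimalPeriod_eq_of_val_label _ (fun _ n => n) (fun x n => (x + n) % 2 = 0) ?_ ?_ ?_ v
  · intro x i x' n n' hx hn hn' hlt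
    fin_cases x <;> simp [-ZMod.val_eq_zero, ZMod.val_add_one_eq_ite (show 2 ≤ m by omega)]
      at hx hn' ⊢ <;> grind
  · grind
  · grind

lemma minimalPeriod_swapSheet_subRight (hm : 6 ≤ m) (hmod : m % 4 = 2) (v : Fin 2 × ZMod m) :
    Function.minimalPeriod (swapSheet (Equiv.subRight 1) (Equiv.subRight 1)) v = m := by
  refine minimalPeriod_eq_of_val_label _ (fun _ n => m - 1 - n) (fun x n => (x + n) % 2 = 0)
    ?_ ?_ ?_ v
  · intro x i x' n n' hx hn hn' hlt
    fin_cases x <;> simp [-ZMod.val_eq_zero, ZMod.val_sub_one_eq_ite (show 2 ≤ m by omega)]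
      at hx hn' ⊢ <;> grind
  · grind
  · grind

lemma minimalPeriod_swapSheet_even_odd (hm : 6 ≤ m) (hmod : m % 4 = 2) (v : Fin 2 × ZMod m) :
    Function.minimalPeriod (swapSheet (evenMatch_involutive hm hmod).toPerm
      (oddMatch_involutive hm hmod).toPerm) v = m := by
  refine minimalPeriod_eq_of_val_label _ (fun x n => if (x + n) % 2 = 0 then n else m - 1 - n)
    (fun x n => (x + n) % 2 = 0) ?_ ?_ ?_ v
  · intro x i x' n n' hx hn hn' hlt
    fin_cases x <;> simp [-ZMod.val_eq_zero, val_evenMatch hm hmod, val_oddMatch hm hmod]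
      at hx hn' ⊢ <;> grind
  · grind
  · grind

lemma minimalPeriod_swapSheet_odd_rung (hm : 6 ≤ m) (hmod : m % 4 = 2) (v : Fin 2 × ZMod m) :
    Function.minimalPeriod (swapSheet (oddMatch_involutive hm hmod).toPerm
      (rungMatch_involutive hm hmod).toPerm) v = m := by
  refine minimalPeriod_eq_of_val_label _
    (fun x n =>
      if x = 0 then
        if n % 2 = 1 then (if n < m / 2 then 2 * n else 2 * n - m)
        else if n = 0 then 0 else if n < m / 2 then m - 2 * n else 2 * m - 2 * n
      else
        if n % 2 = 1 then (if n < m / 2 then m - 2 * n - 1 else 2 * m - 2 * n - 1)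
        else if n = 0 then m - 1 else if n < m / 2 then 2 * n - 1 else 2 * n - m - 1)
    (fun x n =>
      if x = 0 then (n % 2 = 1 ∧ n < m / 2) ∨ (n % 2 = 0 ∧ (m / 2 < n ∨ n = 0))
      else (n % 2 = 1 ∧ m / 2 ≤ n) ∨ (n % 2 = 0 ∧ n ≠ 0 ∧ n < m / 2)) ?_ ?_ ?_ v
  · intro x i x' n n' hx hn hn' hlt
    fin_cases x <;> simp [-ZMod.val_eq_zero, val_rungMatch hm, val_oddMatch hm hmod]
      at hx hn' ⊢ <;> grind
  · grind
  · grind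

lemma minimalPeriod_swapSheet_rung_even (hm : 6 ≤ m) (hmod : m % 4 = 2) (v : Fin 2 × ZMod m) :
    Function.minimalPeriod (swapSheet (rungMatch_involutive hm hmod).toPerm
      (evenMatch_involutive hm hmod).toPerm) v = m := by
  refine minimalPeriod_eq_of_val_label _
    (fun x n =>
      if x = 0 then
        if n % 2 = 1 then (if n ≤ m / 2 then 2 * n - 1 else 2 * n - m - 1)
        else if n = 0 then m - 1 else if n < m / 2 then m - 2 * n - 1 else 2 * m - 2 * n - 1
      else
        if n % 2 = 1 then (if n ≤ m / 2 then m - 2 * n else 2 * m - 2 * n)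
        else if n = 0 then 0 else if n < m / 2 then 2 * n else 2 * n - m)
    (fun x n =>
      if x = 0 then (n % 2 = 1 ∧ n ≤ m / 2) ∨ (n % 2 = 0 ∧ m / 2 < n)
      else (n % 2 = 1 ∧ m / 2 < n) ∨ (n % 2 = 0 ∧ n < m / 2)) ?_ ?_ ?_ v
  · intro x i x' n n' hx hn hn' hlt
    fin_cases x <;> simp [-ZMod.val_eq_zero, val_rungMatch hm, val_evenMatch hm hmod]
      at hx hn' ⊢ <;> grind
  · grind
  · grind

end Matchings

/-- At every point, the matchings `a` and `b` take the two distinct values of `t` and `u` in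
some order, and the matching `c` takes a third value. -/
structure SplitsIntoMatchings {W : Type} (t u a b c : Equiv.Perm W) : Prop where
  split : ∀ i, (a i = t i ∧ b i = u i) ∨ (a i = u i ∧ b i = t i)
  fst_ne_snd : ∀ i, t i ≠ u i
  ne_fst : ∀ i, c i ≠ t i
  ne_snd : ∀ i, c i ≠ u i

section Assembly

variable {W : Type} {A : Set ((Fin 2 × W) × (Fin 2 × W))} {t u a b c : Equiv.Perm W}

/-- A criterion for `IsFactorization` on two sheets, when the arcs join every `(x, i)` to
the vertices over `t i`, `u i` and `c i`. -/
lemma isFactorization_of_forall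
    (hA : ∀ (x y : Fin 2) (i j : W), ((x, i), (y, j)) ∈ A ↔ t i = j ∨ u i = j ∨ c i = j)
    {k : ℕ} {l : Fin k → ℕ} (f : Fin k → Equiv.Perm (Fin 2 × W))
    (hper : ∀ n v, Function.minimalPeriod (f n) v = l n)
    (hdisj : ∀ i x n n', f n (x, i) = f n' (x, i) → n = n')
    (hcover : ∀ i j x y, (∃ n, f n (x, i) = (y, j)) ↔ t i = j ∨ u i = j ∨ c i = j) :
    IsFactorization A l := by
  refine ⟨f, hper, fun n n' v => hdisj v.2 v.1 n n', ?_⟩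
  rintro ⟨⟨x, i⟩, ⟨y, j⟩⟩
  rw [hA, ← hcover i j x y]

lemma isFactorization_oneMatching (h : SplitsIntoMatchings t u a b c)
    (hA : ∀ (x y : Fin 2) (i j : W), ((x, i), (y, j)) ∈ A ↔ t i = j ∨ u i = j ∨ c i = j)
    {l : Fin 6 → ℕ}
    (hper : ∀ n v, Function.minimalPeriod
      ((![keepSheet c, keepSheet t, keepSheet u, swapSheet a b, swapSheet b c, swapSheet c a] :
        Fin 6 → Equiv.Perm (Fin 2 × W)) n) v = l n) :
    IsFactorization A l := by
  refine isFactorization_of_forall hA _ hper (fun i => ?_) (fun i j => ?_)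
  · rcases h.split i with ⟨h₁, h₂⟩ | ⟨h₁, h₂⟩ <;>
      simp [Fin.forall_fin_succ, h₁, h₂, h.fst_ne_snd, h.ne_fst, h.ne_snd, (h.fst_ne_snd i).symm,
        (h.ne_fst i).symm, (h.ne_snd i).symm]
  · rcases h.split i with ⟨h₁, h₂⟩ | ⟨h₁, h₂⟩ <;>
      simp [Fin.forall_fin_succ, Fin.exists_fin_succ, h₁, h₂] <;> tauto

lemma isFactorization_twoMatchings (h : SplitsIntoMatchings t u a b c)
    (hA : ∀ (x y : Fin 2) (i j : W), ((x, i), (y, j)) ∈ A ↔ t i = j ∨ u i = j ∨ c i = j)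
    {l : Fin 6 → ℕ}
    (hper : ∀ n v, Function.minimalPeriod
      ((![keepSheet c, swapSheet c c, keepSheet t, keepSheet u, swapSheet t t, swapSheet u u] :
        Fin 6 → Equiv.Perm (Fin 2 × W)) n) v = l n) :
    IsFactorization A l := by
  refine isFactorization_of_forall hA _ hper (fun i => ?_) (fun i j => ?_)
  · simp [Fin.forall_fin_succ, h.fst_ne_snd, h.ne_fst, h.ne_snd, (h.fst_ne_snd i).symm,
        (h.ne_fst i).symm, (h.ne_snd i).symm]
  · simp [Fin.forall_fin_succ, Fin.exists_fin_succ]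
    tauto

lemma isFactorization_threeMatchings (h : SplitsIntoMatchings t u a b c)
    (hA : ∀ (x y : Fin 2) (i j : W), ((x, i), (y, j)) ∈ A ↔ t i = j ∨ u i = j ∨ c i = j)
    {l : Fin 6 → ℕ}
    (hper : ∀ n v, Function.minimalPeriod
      ((![keepSheet a, keepSheet b, keepSheet c, swapSheet a b, swapSheet b c, swapSheet c a] :
        Fin 6 → Equiv.Perm (Fin 2 × W)) n) v = l n) :
    IsFactorization A l := by
  refine isFactorization_of_forall hA _ hper (fun i => ?_) (fun i j => ?_)
  · rcases h.split i with ⟨h₁, h₂⟩ | ⟨h₁, h₂⟩ <;>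
      simp [Fin.forall_fin_succ, h₁, h₂, h.fst_ne_snd, h.ne_fst, h.ne_snd, (h.fst_ne_snd i).symm,
        (h.ne_fst i).symm, (h.ne_snd i).symm]
  · rcases h.split i with ⟨h₁, h₂⟩ | ⟨h₁, h₂⟩ <;>
      simp [Fin.forall_fin_succ, Fin.exists_fin_succ, h₁, h₂] <;> tauto

lemma isFactorization_fourMatchings (h : SplitsIntoMatchings t u a b c)
    (hA : ∀ (x y : Fin 2) (i j : W), ((x, i), (y, j)) ∈ A ↔ t i = j ∨ u i = j ∨ c i = j)
    {l : Fin 6 → ℕ}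
    (hper : ∀ n v, Function.minimalPeriod
      ((![keepSheet a, keepSheet b, keepSheet c, swapSheet c c, swapSheet t t, swapSheet u u] :
        Fin 6 → Equiv.Perm (Fin 2 × W)) n) v = l n) :
    IsFactorization A l := by
  refine isFactorization_of_forall hA _ hper (fun i => ?_) (fun i j => ?_)
  · rcases h.split i with ⟨h₁, h₂⟩ | ⟨h₁, h₂⟩ <;>
      simp [Fin.forall_fin_succ, h₁, h₂, h.fst_ne_snd, h.ne_fst, h.ne_snd, (h.fst_ne_snd i).symm,
        (h.ne_fst i).symm, (h.ne_snd i).symm]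
  · rcases h.split i with ⟨h₁, h₂⟩ | ⟨h₁, h₂⟩ <;>
      simp [Fin.forall_fin_succ, Fin.exists_fin_succ, h₁, h₂] <;> tauto

lemma isFactorization_sixMatchings (h : SplitsIntoMatchings t u a b c)
    (hA : ∀ (x y : Fin 2) (i j : W), ((x, i), (y, j)) ∈ A ↔ t i = j ∨ u i = j ∨ c i = j)
    {l : Fin 6 → ℕ}
    (hper : ∀ n v, Function.minimalPeriod
      ((![keepSheet a, keepSheet b, keepSheet c, swapSheet a a, swapSheet b b, swapSheet c c] :
        Fin 6 → Equiv.Perm (Fin 2 × W)) n) v = l n) :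
    IsFactorization A l := by
  refine isFactorization_of_forall hA _ hper (fun i => ?_) (fun i j => ?_)
  · rcases h.split i with ⟨h₁, h₂⟩ | ⟨h₁, h₂⟩ <;>
      simp [Fin.forall_fin_succ, h₁, h₂, h.fst_ne_snd, h.ne_fst, h.ne_snd, (h.fst_ne_snd i).symm,
        (h.ne_fst i).symm, (h.ne_snd i).symm]
  · rcases h.split i with ⟨h₁, h₂⟩ | ⟨h₁, h₂⟩ <;>
      simp [Fin.forall_fin_succ, Fin.exists_fin_succ, h₁, h₂]
    tauto

end Assembly

/-- For `m ≡ 2 (mod 4)` with `m ≥ 6`, the digraph `Γ*_m = C*[2] ⊕ F_m*[2]` has a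
factorization into `r` `K_2*`-factors and `s` `C⃗_m`-factors for every
`r ∈ {1, 2, 3, 4, 6}` with `r + s = 6`. -/
theorem gammaStar_K2_Cm_two_mod_four (m r s : ℕ) (hm : 6 ≤ m) (hmod : m % 4 = 2)
    (hr : r = 1 ∨ r = 2 ∨ r = 3 ∨ r = 4 ∨ r = 6) (hrs : r + s = 6) :
    IsFactorization (GammaStar m)
      (fun i : Fin (r + s) => if (i : ℕ) < r then 2 else m) := by
  have : NeZero m := ⟨by omega⟩
  have even := evenMatch_involutive hm hmod
  have odd := oddMatch_involutive hm hmod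
  have rung := rungMatch_involutive hm hmod
  have h : SplitsIntoMatchings (Equiv.addRight 1) (Equiv.subRight 1)
      even.toPerm odd.toPerm rung.toPerm :=
    { split := fun i => by
        simp only [Function.Involutive.coe_toPerm, evenMatch, oddMatch, Equiv.coe_addRight,
          Equiv.subRight_apply]
        split_ifs <;> simp
      fst_ne_snd := add_one_ne_sub_one hm
      ne_fst := rungMatch_ne_add_one hm hmod
      ne_snd := rungMatch_ne_sub_one hm hmod }
  have hA := mem_GammaStar_iff hm
  have pa := minimalPeriod_keepSheet even.toPerm even (evenMatch_ne_self hm hmod)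
  have pb := minimalPeriod_keepSheet odd.toPerm odd (oddMatch_ne_self hm hmod)
  have pc := minimalPeriod_keepSheet rung.toPerm rung (rungMatch_ne_self hm hmod)
  have qa := minimalPeriod_swapSheet even.toPerm even
  have qb := minimalPeriod_swapSheet odd.toPerm odd
  have qc := minimalPeriod_swapSheet rung.toPerm rung
  have pt := minimalPeriod_keepSheet_addRight hm
  have pu := minimalPeriod_keepSheet_subRight hm
  have qt := minimalPeriod_swapSheet_addRight hm hmod
  have qu := minimalPeriod_swapSheet_subRight hm hmod
  have qab := minimalPeriod_swapSheet_even_odd hm hmod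
  have qbc := minimalPeriod_swapSheet_odd_rung hm hmod
  have qca := minimalPeriod_swapSheet_rung_even hm hmod
  rcases hr with rfl | rfl | rfl | rfl | rfl
  · obtain rfl : s = 5 := by omega
    refine isFactorization_oneMatching h hA fun n => ?_
    fin_cases n
    exacts [pc, pt, pu, qab, qbc, qca]
  · obtain rfl : s = 4 := by omega
    refine isFactorization_twoMatchings h hA fun n => ?_
    fin_cases n
    exacts [pc, qc, pt, pu, qt, qu]
  · obtain rfl : s = 3 := by omega
    refine isFactorization_threeMatchings h hA fun n => ?_
    fin_cases n
    exacts [pa, pb, pc, qab, qbc, qca]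
  · obtain rfl : s = 2 := by omega
    refine isFactorization_fourMatchings h hA fun n => ?_
    fin_cases n
    exacts [pa, pb, pc, qc, qt, qu]
  · obtain rfl : s = 0 := by omega
    refine isFactorization_sixMatchings h hA fun n => ?_
    fin_cases n
    exacts [pa, pb, pc, qa, qb, qc]
end

section
/- The complete symmetric digraph K_12* has a factorization into r K_2*-factors and s C⃗_4-factors for every r ∈ {0, 1, 2, 3, 4, 5, 7, 9, 11} with r + s = 11. -/
/-- A one-factorization of `K₁₂`; after the first, consecutive one-factors pair up into
`C₄`-factors. -/
def oddOneFactors : List (Fin 12 → Fin 12) :=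
  [![9, 10, 11, 6, 7, 8, 3, 4, 5, 0, 1, 2],
   ![8, 3, 5, 1, 11, 2, 7, 6, 0, 10, 9, 4],
   ![4, 2, 1, 5, 0, 3, 10, 9, 11, 7, 6, 8],
   ![2, 6, 0, 4, 3, 9, 1, 8, 7, 5, 11, 10],
   ![3, 5, 4, 0, 2, 1, 9, 11, 10, 6, 8, 7],
   ![5, 4, 7, 10, 1, 0, 11, 2, 9, 8, 3, 6],
   ![1, 0, 3, 2, 5, 4, 8, 10, 6, 11, 7, 9],
   ![6, 7, 8, 11, 9, 10, 0, 1, 2, 4, 5, 3],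
   ![10, 11, 9, 7, 8, 6, 5, 3, 4, 2, 0, 1],
   ![7, 8, 6, 9, 10, 11, 2, 0, 1, 3, 4, 5],
   ![11, 9, 10, 8, 6, 7, 4, 5, 3, 1, 2, 0]]

/-- The two orientations of each `C₄`-factor obtained from `oddOneFactors`. -/
def oddFourCycleFactors : List (Fin 12 → Fin 12) :=
  [![8, 3, 1, 5, 0, 2, 7, 9, 11, 10, 6, 4],
   ![4, 2, 5, 1, 11, 3, 10, 6, 0, 7, 9, 8],
   ![2, 6, 4, 0, 3, 1, 9, 8, 10, 5, 11, 7],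
   ![3, 5, 0, 4, 2, 9, 1, 11, 7, 6, 8, 10],
   ![5, 0, 7, 2, 1, 4, 11, 10, 6, 8, 3, 9],
   ![1, 4, 3, 10, 5, 0, 8, 2, 9, 11, 7, 6],
   ![6, 7, 8, 11, 9, 10, 5, 3, 4, 2, 0, 1],
   ![10, 11, 9, 7, 8, 6, 0, 1, 2, 4, 5, 3],
   ![7, 8, 6, 9, 10, 11, 4, 5, 3, 1, 2, 0],
   ![11, 9, 10, 8, 6, 7, 2, 0, 1, 3, 4, 5]]

/-- Four disjoint one-factors of `K₁₂`; consecutive ones pair up into `C₄`-factors. -/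
def evenOneFactors : List (Fin 12 → Fin 12) :=
  [![7, 10, 3, 2, 5, 4, 9, 0, 11, 6, 1, 8],
   ![9, 11, 5, 4, 3, 2, 7, 6, 10, 0, 8, 1],
   ![6, 5, 9, 7, 8, 1, 0, 3, 4, 2, 11, 10],
   ![10, 4, 7, 9, 1, 8, 11, 2, 5, 3, 0, 6]]

/-- A `C⃗₄`-factorization of `K₁₂*` whose first four factors are the orientations of the
`C₄`-factors obtained from `evenOneFactors`. -/
def evenFourCycleFactors : List (Fin 12 → Fin 12) :=
  [![7, 10, 3, 4, 5, 2, 9, 6, 11, 0, 8, 1],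
   ![9, 11, 5, 2, 3, 4, 7, 0, 10, 6, 1, 8],
   ![6, 5, 9, 7, 1, 8, 11, 2, 4, 3, 0, 10],
   ![10, 4, 7, 9, 8, 1, 0, 3, 5, 2, 11, 6],
   ![1, 7, 10, 5, 2, 6, 8, 11, 3, 4, 9, 0],
   ![8, 3, 1, 10, 0, 9, 4, 5, 6, 11, 2, 7],
   ![3, 9, 4, 11, 7, 0, 1, 8, 2, 10, 6, 5],
   ![5, 8, 11, 0, 6, 10, 2, 9, 7, 1, 3, 4],
   ![11, 2, 6, 1, 10, 7, 3, 4, 0, 8, 5, 9],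
   ![4, 6, 0, 8, 11, 3, 10, 1, 9, 5, 7, 2],
   ![2, 0, 8, 6, 9, 11, 5, 10, 1, 7, 4, 3]]

/-- Maps without fixed points, the first `r` of them involutions and the others of order four with
fixed-point-free square, factorize the complete symmetric digraph as soon as they are pairwise
disjoint and there are `|V| - 1` of them. -/
theorem isFactorization_complete_of_maps {V : Type} [Fintype V] {r s : ℕ}
    (hcard : Fintype.card V = r + s + 1) (T : Fin (r + s) → V → V)
    (hne : ∀ i x, T i x ≠ x)
    (hinv : ∀ i : Fin (r + s), (i : ℕ) < r → ∀ x, T i (T i x) = x)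
    (hfour : ∀ i : Fin (r + s), r ≤ (i : ℕ) → ∀ x,
      T i (T i x) ≠ x ∧ T i (T i (T i (T i x))) = x)
    (hdisj : ∀ x i j, T i x = T j x → i = j) :
    IsFactorization {p : V × V | p.1 ≠ p.2}
      (fun i : Fin (r + s) => if (i : ℕ) < r then 2 else 4) := by
  have hT : ∀ i x, T i (T i (T i (T i x))) = x := fun i x => by
    by_cases h : (i : ℕ) < r
    · rw [hinv i h, hinv i h]
    · exact (hfour i (not_lt.mp h) x).2
  refine ⟨fun i => ⟨T i, fun x => T i (T i (T i x)), hT i, hT i⟩, fun i x => ?_,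
    fun i j x => hdisj x i j, ?_⟩
  · change Function.minimalPeriod (T i) x = _
    beta_reduce
    split_ifs with h
    · exact Function.minimalPeriod_eq_prime (p := 2) (hinv i h x) (hne i x)
    · obtain ⟨h₂, h₄⟩ := hfour i (not_lt.mp h) x
      exact Function.minimalPeriod_eq_prime_pow (p := 2) (k := 1) h₂ h₄
  · classical
    rintro ⟨x, y⟩
    change x ≠ y ↔ ∃ i, T i x = y
    have himage : Finset.univ.image (fun i => T i x) = Finset.univ.erase x := by
      refine Finset.eq_of_subset_of_card_le (fun z hz => ?_) ?_
      · obtain ⟨i, -, rfl⟩ := Finset.mem_image.mp hz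
        exact Finset.mem_erase.mpr ⟨hne i x, Finset.mem_univ _⟩
      · rw [Finset.card_image_of_injective _ (fun i j => hdisj x i j)]
        simp [hcard]
    have hmem := Finset.ext_iff.mp himage y
    simpa [eq_comm, iff_comm] using hmem

/-- The complete symmetric digraph `K_12*` (arc set: all ordered pairs of distinct
vertices of `Fin 12`) has a factorization into `r` `K_2*`-factors and `s`
`C⃗_4`-factors for every `r ∈ {0, 1, 2, 3, 4, 5, 7, 9, 11}` with `r + s = 11`. -/
theorem K12_K2_C4 (r s : ℕ)
    (hr : r = 0 ∨ r = 1 ∨ r = 2 ∨ r = 3 ∨ r = 4 ∨ r = 5 ∨ r = 7 ∨ r = 9 ∨ r = 11)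
    (hrs : r + s = 11) :
    IsFactorization {p : Fin 12 × Fin 12 | p.1 ≠ p.2}
      (fun i : Fin (r + s) => if (i : ℕ) < r then 2 else 4) := by
  have factor (L : List (Fin 12 → Fin 12)) :=
    isFactorization_complete_of_maps (V := Fin 12) (r := r) (s := s) (by simp [hrs]) (fun i => L.getD i id)
  obtain rfl : s = 11 - r := by omega
  rcases hr with rfl | rfl | rfl | rfl | rfl | rfl | rfl | rfl | rfl
  · apply factor evenFourCycleFactors <;> decide +kernel
  · apply factor (oddOneFactors.take 1 ++ oddFourCycleFactors) <;> decide +kernel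
  · apply factor (evenOneFactors.take 2 ++ evenFourCycleFactors.drop 2) <;> decide +kernel
  · apply factor (oddOneFactors.take 3 ++ oddFourCycleFactors.drop 2) <;> decide +kernel
  · apply factor (evenOneFactors.take 4 ++ evenFourCycleFactors.drop 4) <;> decide +kernel
  · apply factor (oddOneFactors.take 5 ++ oddFourCycleFactors.drop 4) <;> decide +kernel
  · apply factor (oddOneFactors.take 7 ++ oddFourCycleFactors.drop 6) <;> decide +kernel
  · apply factor (oddOneFactors.take 9 ++ oddFourCycleFactors.drop 8) <;> decide +kernel
  · apply factor oddOneFactors <;> decide +kernel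
end

section
/- The complete symmetric equipartite digraph K_{(4:3)}* has a factorization into r K_2*-factors and s C⃗_4-factors for every r ∈ {0, 1, 2, 4, 6, 8} with r + s = 8. -/
/-- Self-maps all of whose points have period `2`, respectively `4`, as prescribed by `c`, and whose
graphs partition `A`, give a factorization of `A`. -/
theorem IsFactorization.of_maps {V : Type} {A : Set (V × V)} {k : ℕ} {c : Fin k → ℕ}
    (g : Fin k → V → V)
    (hg : ∀ i x, (c i = 2 ∧ g i x ≠ x ∧ g i (g i x) = x) ∨
      (c i = 4 ∧ g i (g i x) ≠ x ∧ g i (g i (g i (g i x))) = x))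
    (hinj : ∀ i j x, g i x = g j x → i = j)
    (hA : ∀ p : V × V, p ∈ A ↔ ∃ i, g i p.1 = p.2) : IsFactorization A c := by
  have h4 : ∀ i x, g i (g i (g i (g i x))) = x := by
    intro i x
    rcases hg i x with ⟨_, _, h⟩ | ⟨_, _, h⟩
    · rw [h, h]
    · exact h
  refine ⟨fun i => ⟨g i, fun x => g i (g i (g i x)), h4 i, h4 i⟩, fun i x => ?_, hinj, hA⟩
  change Function.minimalPeriod (g i) x = c i
  rcases hg i x with ⟨hc, hne, h⟩ | ⟨hc, hne, h⟩
  · rw [hc]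
    exact Function.minimalPeriod_eq_prime h hne
  · rw [hc]
    exact Function.minimalPeriod_eq_prime_pow (p := 2) (k := 1) hne h

/-- The self-map of `Fin 3 × Fin 4` given by a table of values, the vertex `(i, a)` being
numbered `4 * i + a`. -/
def ofTable (t : Fin 12 → Fin 12) (x : Fin 3 × Fin 4) : Fin 3 × Fin 4 :=
  finProdFinEquiv.symm (t (finProdFinEquiv x))

/-- The complete symmetric equipartite digraph `K_{(4:3)}*`, with `3` parts of size `4`
(vertex set `Fin 3 × Fin 4`, a vertex `(i, a)` lying in part `i`) and all ordered pairs
of vertices in distinct parts as arcs, has a factorization into `r` `K_2*`-factors and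
`s` `C⃗_4`-factors for every `r ∈ {0, 1, 2, 4, 6, 8}` with `r + s = 8`. -/
theorem K43_K2_C4 (r s : ℕ)
    (hr : r = 0 ∨ r = 1 ∨ r = 2 ∨ r = 4 ∨ r = 6 ∨ r = 8) (hrs : r + s = 8) :
    IsFactorization {p : (Fin 3 × Fin 4) × (Fin 3 × Fin 4) | p.1.1 ≠ p.2.1}
      (fun i : Fin (r + s) => if (i : ℕ) < r then 2 else 4) := by
  rcases hr with rfl | rfl | rfl | rfl | rfl | rfl
  · obtain rfl : s = 8 := by omega
    refine .of_maps (fun i => ofTable (![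
      ![4, 10, 7, 9, 8, 2, 0, 11, 6, 1, 3, 5],
      ![5, 6, 9, 10, 1, 8, 11, 0, 7, 3, 2, 4],
      ![6, 4, 10, 11, 0, 9, 1, 8, 3, 2, 5, 7],
      ![7, 11, 6, 8, 9, 10, 3, 1, 2, 5, 4, 0],
      ![8, 5, 11, 6, 10, 0, 2, 9, 1, 4, 7, 3],
      ![9, 7, 8, 5, 11, 1, 10, 3, 4, 6, 0, 2],
      ![10, 8, 4, 7, 3, 11, 9, 2, 5, 0, 6, 1],
      ![11, 9, 5, 4, 2, 3, 8, 10, 0, 7, 1, 6]] i)) ?_ ?_ ?_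
    · decide +kernel
    · decide +kernel
    · simp only [Set.mem_ofPred_eq]
      decide +kernel
  · obtain rfl : s = 7 := by omega
    refine .of_maps (fun i => ofTable (![
      ![4, 5, 11, 8, 0, 1, 10, 9, 3, 7, 6, 2],
      ![5, 8, 7, 10, 11, 9, 0, 1, 2, 6, 4, 3],
      ![6, 11, 5, 9, 10, 8, 1, 2, 7, 4, 3, 0],
      ![7, 4, 8, 11, 2, 0, 9, 10, 1, 3, 5, 6],
      ![8, 6, 10, 5, 9, 11, 2, 3, 4, 0, 1, 7],
      ![9, 10, 6, 7, 3, 2, 8, 11, 5, 1, 0, 4],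
      ![10, 9, 4, 6, 1, 3, 11, 8, 0, 2, 7, 5],
      ![11, 7, 9, 4, 8, 10, 3, 0, 6, 5, 2, 1]] i)) ?_ ?_ ?_
    · decide +kernel
    · decide +kernel
    · simp only [Set.mem_ofPred_eq]
      decide +kernel
  · obtain rfl : s = 6 := by omega
    refine .of_maps (fun i => ofTable (![
      ![4, 5, 9, 8, 0, 1, 10, 11, 3, 2, 6, 7],
      ![5, 4, 11, 10, 1, 0, 8, 9, 6, 7, 3, 2],
      ![6, 7, 10, 11, 9, 8, 1, 0, 2, 3, 5, 4],
      ![7, 6, 8, 9, 10, 11, 0, 1, 4, 5, 2, 3],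
      ![8, 9, 7, 6, 11, 10, 2, 3, 1, 0, 4, 5],
      ![9, 8, 5, 4, 2, 3, 11, 10, 7, 6, 1, 0],
      ![10, 11, 4, 5, 3, 2, 9, 8, 0, 1, 7, 6],
      ![11, 10, 6, 7, 8, 9, 3, 2, 5, 4, 0, 1]] i)) ?_ ?_ ?_
    · decide +kernel
    · decide +kernel
    · simp only [Set.mem_ofPred_eq]
      decide +kernel
  · obtain rfl : s = 4 := by omega
    refine .of_maps (fun i => ofTable (![
      ![4, 5, 9, 8, 0, 1, 10, 11, 3, 2, 6, 7],
      ![5, 4, 11, 10, 1, 0, 8, 9, 6, 7, 3, 2],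
      ![6, 7, 10, 9, 8, 11, 0, 1, 4, 3, 2, 5],
      ![7, 6, 8, 11, 10, 9, 1, 0, 2, 5, 4, 3],
      ![8, 9, 7, 6, 11, 10, 2, 3, 5, 4, 0, 1],
      ![9, 8, 6, 7, 2, 3, 11, 10, 0, 1, 5, 4],
      ![10, 11, 5, 4, 9, 8, 3, 2, 7, 6, 1, 0],
      ![11, 10, 4, 5, 3, 2, 9, 8, 1, 0, 7, 6]] i)) ?_ ?_ ?_
    · decide +kernel
    · decide +kernel
    · simp only [Set.mem_ofPred_eq]
      decide +kernel
  · obtain rfl : s = 2 := by omega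
    refine .of_maps (fun i => ofTable (![
      ![4, 5, 9, 8, 0, 1, 10, 11, 3, 2, 6, 7],
      ![5, 4, 11, 10, 1, 0, 8, 9, 6, 7, 3, 2],
      ![6, 7, 10, 9, 8, 11, 0, 1, 4, 3, 2, 5],
      ![7, 6, 8, 11, 10, 9, 1, 0, 2, 5, 4, 3],
      ![8, 9, 7, 6, 11, 10, 3, 2, 0, 1, 5, 4],
      ![9, 8, 5, 4, 3, 2, 11, 10, 1, 0, 7, 6],
      ![10, 11, 6, 7, 2, 3, 9, 8, 5, 4, 1, 0],
      ![11, 10, 4, 5, 9, 8, 2, 3, 7, 6, 0, 1]] i)) ?_ ?_ ?_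
    · decide +kernel
    · decide +kernel
    · simp only [Set.mem_ofPred_eq]
      decide +kernel
  · obtain rfl : s = 0 := by omega
    refine .of_maps (fun i => ofTable (![
      ![4, 5, 9, 8, 0, 1, 10, 11, 3, 2, 6, 7],
      ![5, 4, 11, 10, 1, 0, 8, 9, 6, 7, 3, 2],
      ![6, 7, 10, 9, 8, 11, 0, 1, 4, 3, 2, 5],
      ![7, 6, 8, 11, 10, 9, 1, 0, 2, 5, 4, 3],
      ![8, 9, 7, 6, 11, 10, 3, 2, 0, 1, 5, 4],
      ![9, 8, 5, 4, 3, 2, 11, 10, 1, 0, 7, 6],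
      ![10, 11, 6, 7, 9, 8, 2, 3, 5, 4, 0, 1],
      ![11, 10, 4, 5, 2, 3, 9, 8, 7, 6, 1, 0]] i)) ?_ ?_ ?_
    · decide +kernel
    · decide +kernel
    · simp only [Set.mem_ofPred_eq]
      decide +kernel
end
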